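/- Let d ≥ 1, 0 < α_i ≤ 1, p_0 := max{1/(1+α_i)}, γ a CRF, L the associated cone-like set, and p_0 < p ≤ 1. Then the maximal operator σ_L^{κ,α,*} is p-quasilocal in the following modified sense: there exist r ∈ N and a constant c_p such that for every p-atom a with support I = I_{N_1}×⋯×I_{N_d} (where 2^{N_j} ≤ γ_j(2^{N_1}) < 2^{N_j+1}, j=2,…,d, and N_j − r ≥ 0 for all j), one has ∫_{G^d ∖ I^r} |σ_L^{κ,α,*} a|^p dμ ≤ c_p, where I^r := I_{N_1−r}×⋯×I_{N_d−r}. -/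

import Mathlib

open MeasureTheory Filter Finset ENNReal

noncomputable section

/-- The Walsh group `G`: countable product of copies of `ℤ/2ℤ`. -/
abbrev WG : Type := ℕ → ZMod 2

/-- The normalized Haar measure (= product of uniform coin-toss measures) on `G`. -/
def μW : Measure WG := Measure.addHaarMeasure ⊤

instance : (μW).Regular := by unfold μW; infer_instance

instance : IsFiniteMeasure μW := by
  constructor
  rw [← TopologicalSpace.PositiveCompacts.coe_top (α := WG)]
  exact IsCompact.measure_lt_top (⊤ : TopologicalSpace.PositiveCompacts WG).isCompact

/-- The product measure on `G^d`. -/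
def μD (d : ℕ) : Measure (Fin d → WG) := Measure.pi fun _ => μW

/-- The `k`-th Rademacher function. -/
def rad (k : ℕ) (x : WG) : ℝ := (-1 : ℝ) ^ (x k).val

/-- The Walsh–Paley function of index `n`. -/
def walsh (n : ℕ) (x : WG) : ℝ :=
  ∏ k ∈ Finset.range n.size, if n.testBit k then rad k x else 1

/-- The Walsh–Kaczmarz function of index `n`; `Nat.log 2 n` is the order `|n|`. -/
def kacz (n : ℕ) (x : WG) : ℝ :=
  if n = 0 then 1 else
    rad (Nat.log 2 n) x *
      (-1 : ℝ) ^ (∑ k ∈ Finset.range (Nat.log 2 n),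
        (if n.testBit k then 1 else 0) * (x (Nat.log 2 n - 1 - k)).val)

/-- The `d`-dimensional Walsh–Kaczmarz function. -/
def kaczD (d : ℕ) (m : Fin d → ℕ) (x : Fin d → WG) : ℝ := ∏ i, kacz (m i) (x i)

/-- Walsh–Paley Dirichlet kernel. -/
def dirW (n : ℕ) (x : WG) : ℝ := ∑ k ∈ Finset.range n, walsh k x

/-- Walsh–Kaczmarz Dirichlet kernel. -/
def dirK (n : ℕ) (x : WG) : ℝ := ∑ k ∈ Finset.range n, kacz k x

/-- `A_j^α = binom (j+α) j`. -/
def Abin (α : ℝ) (j : ℕ) : ℝ := ∏ i ∈ Finset.range j, (α + i + 1) / (i + 1)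

/-- One-dimensional Walsh–Paley `(C,α)` kernel. -/
def KW (α : ℝ) (n : ℕ) (x : WG) : ℝ :=
  (Abin α n)⁻¹ * ∑ k ∈ Finset.range (n + 1), Abin (α - 1) (n - k) * dirW k x

/-- One-dimensional Walsh–Kaczmarz `(C,α)` kernel. -/
def KK (α : ℝ) (n : ℕ) (x : WG) : ℝ :=
  (Abin α n)⁻¹ * ∑ k ∈ Finset.range (n + 1), Abin (α - 1) (n - k) * dirK k x

/-- The `m`-th Walsh–Kaczmarz–Fourier coefficient of `f : G^d → ℝ`. -/
def fCoeff (d : ℕ) (f : (Fin d → WG) → ℝ) (m : Fin d → ℕ) : ℝ :=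
  ∫ x, f x * kaczD d m x ∂ μD d

/-- Rectangular partial sum built from an abstract family `c` of Fourier coefficients. -/
def partialSumOf (d : ℕ) (c : (Fin d → ℕ) → ℝ) (k : Fin d → ℕ) (x : Fin d → WG) : ℝ :=
  ∑ m ∈ Fintype.piFinset (fun i => Finset.range (k i)), c m * kaczD d m x

/-- `(C,α)` (Cesàro) mean of order `n` built from coefficients `c`. -/
def cesaroOf (d : ℕ) (α : Fin d → ℝ) (c : (Fin d → ℕ) → ℝ) (n : Fin d → ℕ)
    (x : Fin d → WG) : ℝ :=
  (∏ i, Abin (α i) (n i))⁻¹ *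
    ∑ k ∈ Fintype.piFinset (fun i => Finset.range (n i + 1)),
      (∏ i, Abin (α i - 1) (n i - k i)) * partialSumOf d c k x

/-- A cone-like restriction function (CRF) family `γ = (γ_j)_{j ≠ 0}`. -/
structure IsCRF (d : ℕ) [NeZero d] (γ : Fin d → ℝ → ℝ) : Prop where
  strictMono : ∀ j : Fin d, j ≠ 0 → StrictMonoOn (γ j) (Set.Ici 1)
  contOn : ∀ j : Fin d, j ≠ 0 → ContinuousOn (γ j) (Set.Ici 1)
  one_le : ∀ j : Fin d, j ≠ 0 → ∀ x : ℝ, 1 ≤ x → 1 ≤ γ j x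
  map_one : ∀ j : Fin d, j ≠ 0 → γ j 1 = 1
  tendsto_atTop : ∀ j : Fin d, j ≠ 0 → Tendsto (γ j) atTop atTop
  reg : ∃ ζ : ℝ, 1 < ζ ∧ ∀ j : Fin d, j ≠ 0 → ∃ c₁ c₂ : ℝ, 1 < c₁ ∧ 1 < c₂ ∧
    ∀ x : ℝ, 1 ≤ x → c₁ * γ j x ≤ γ j (ζ * x) ∧ γ j (ζ * x) ≤ c₂ * γ j x

/-- The cone-like set `L` determined by `γ` and the parameters `β`. -/
def coneLike (d : ℕ) [NeZero d] (γ : Fin d → ℝ → ℝ) (β : Fin d → ℝ) : Set (Fin d → ℕ) :=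
  {n | ∀ j : Fin d, j ≠ 0 → (β j)⁻¹ * γ j (n 0) ≤ (n j : ℝ) ∧ (n j : ℝ) ≤ β j * γ j (n 0)}

/-- `bar γ n₁ = (n₁, n₂, …, n_d)` where `n_j = |γ_j(2^{n₁})|` is the order of `γ_j(2^{n₁})`,
i.e. `2^{n_j} ≤ γ_j(2^{n₁}) < 2^{n_j+1}`. -/
def bar (d : ℕ) [NeZero d] (γ : Fin d → ℝ → ℝ) (n₁ : ℕ) : Fin d → ℕ :=
  fun j => if j = 0 then n₁ else Nat.log 2 ⌊γ j ((2 : ℝ) ^ n₁)⌋₊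

/-- The cone-like restricted maximal operator `σ_L^{κ,α,*}` (built from coefficients `c`). -/
def cesaroMaximal (d : ℕ) [NeZero d] (α : Fin d → ℝ) (γ : Fin d → ℝ → ℝ) (β : Fin d → ℝ)
    (c : (Fin d → ℕ) → ℝ) (x : Fin d → WG) : ℝ≥0∞ :=
  ⨆ n ∈ coneLike d γ β, ENNReal.ofReal |cesaroOf d α c n x|

/-- `L^p`-"norm" (`0 < p < ∞`) of an `ℝ≥0∞`-valued function on `G^d`. -/
def lpNormE (d : ℕ) (p : ℝ) (g : (Fin d → WG) → ℝ≥0∞) : ℝ≥0∞ :=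
  (∫⁻ x, g x ^ p ∂ μD d) ^ (1 / p)

/-- The dyadic rectangle `I_{N}(y) = I_{N_1}(y^1) × ⋯ × I_{N_d}(y^d)`. -/
def rectAt (d : ℕ) (N : Fin d → ℕ) (y : Fin d → WG) : Set (Fin d → WG) :=
  {x | ∀ j : Fin d, ∀ i : ℕ, i < N j → x j i = y j i}

/-- The one-dimensional dyadic interval `I_N = I_N(0)`. -/
def rectW (N : ℕ) : Set WG := {x | ∀ i : ℕ, i < N → x i = 0}

/-- A one-parameter martingale with respect to the filtration
`(F_{bar γ n₁})_{n₁}` generated by the dyadic rectangles `I_{bar γ n₁}(y)`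
(measurability w.r.t. this atomic σ-algebra = being constant on its rectangles,
and the martingale property = equality of integrals over the rectangles). -/
structure ConeMartingale (d : ℕ) [NeZero d] (γ : Fin d → ℝ → ℝ) where
  F : ℕ → (Fin d → WG) → ℝ
  integrable : ∀ n₁, Integrable (F n₁) (μD d)
  adapted : ∀ n₁ (x y : Fin d → WG),
    (∀ j : Fin d, ∀ i : ℕ, i < bar d γ n₁ j → x j i = y j i) → F n₁ x = F n₁ y
  mart : ∀ n₁ m₁, n₁ ≤ m₁ → ∀ y,
    ∫ x in rectAt d (bar d γ n₁) y, F m₁ x ∂ μD d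
      = ∫ x in rectAt d (bar d γ n₁) y, F n₁ x ∂ μD d

/-- The Fourier coefficients of a martingale (the integrals `∫ f_k ψ_m` stabilize). -/
def martCoeff (d : ℕ) [NeZero d] (γ : Fin d → ℝ → ℝ) (f : ConeMartingale d γ) (m : Fin d → ℕ) : ℝ :=
  limUnder atTop (fun k => ∫ x, f.F k x * kaczD d m x ∂ μD d)

/-- The maximal function `f* = sup_{n₁} |f_{bar n₁}|` of a martingale. -/
def martMaximal (d : ℕ) [NeZero d] (γ : Fin d → ℝ → ℝ) (f : ConeMartingale d γ)
    (x : Fin d → WG) : ℝ≥0∞ :=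
  ⨆ n₁ : ℕ, ENNReal.ofReal |f.F n₁ x|

/-- The martingale Hardy space "norm" `‖f‖_{H_p^γ} = ‖f*‖_p`. -/
def hardyNorm (d : ℕ) [NeZero d] (γ : Fin d → ℝ → ℝ) (p : ℝ) (f : ConeMartingale d γ) : ℝ≥0∞ :=
  lpNormE d p (martMaximal d γ f)

/-- A `p`-atom supported on the rectangle `I_N(y)`. -/
structure IsPAtom (d : ℕ) (p : ℝ) (a : (Fin d → WG) → ℝ) (N : Fin d → ℕ)
    (y : Fin d → WG) : Prop where
  measurable : Measurable a
  support : ∀ x, x ∉ rectAt d N y → a x = 0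
  bound : ∀ x, |a x| ≤ ((μD d (rectAt d N y)).toReal) ^ (-(1 / p))
  zero : ∫ x, a x ∂ μD d = 0

/-- The conditional-expectation (dyadic average) of `f` at level `N`. -/
def avgAt (d : ℕ) (N : Fin d → ℕ) (f : (Fin d → WG) → ℝ) (x : Fin d → WG) : ℝ :=
  (2 : ℝ) ^ (∑ j, N j) * ∫ t in rectAt d N x, f t ∂ μD d

/-- `m` is the martingale generated by the integrable function `f`. -/
def inducedLevels (d : ℕ) [NeZero d] (γ : Fin d → ℝ → ℝ) (f : (Fin d → WG) → ℝ)
    (m : ConeMartingale d γ) : Prop :=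
  ∀ n₁ x, m.F n₁ x = avgAt d (bar d γ n₁) f x

/-- The martingale maximal function of (the martingale generated by) a function `f`,
`f* = sup_{n₁} |S_{2^{bar γ n₁}} f|`. -/
def funMaximal (d : ℕ) [NeZero d] (γ : Fin d → ℝ → ℝ) (f : (Fin d → WG) → ℝ)
    (x : Fin d → WG) : ℝ≥0∞ :=
  ⨆ n₁ : ℕ, ENNReal.ofReal |partialSumOf d (fCoeff d f) (fun j => 2 ^ bar d γ n₁ j) x|

/-- The Hardy norm `‖f‖_{H_p^γ}` of (the martingale generated by) a function `f`. -/
def funHardyNorm (d : ℕ) [NeZero d] (γ : Fin d → ℝ → ℝ) (p : ℝ) (f : (Fin d → WG) → ℝ) : ℝ≥0∞ :=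
  lpNormE d p (funMaximal d γ f)

/-- Skvortsov's bit-reversal transformation `τ_A`. -/
def tau (A : ℕ) (x : WG) : WG := fun i => if i < A then x (A - 1 - i) else x i

end

noncomputable section

section CesaroNumbers

lemma Abin_zero (α : ℝ) : Abin α 0 = 1 := by simp [Abin]

lemma Abin_succ (α : ℝ) (n : ℕ) : Abin α (n + 1) = Abin α n * ((α + n + 1) / (n + 1)) :=
  Finset.prod_range_succ _ _

lemma Abin_pos {α : ℝ} (hα : -1 < α) (n : ℕ) : 0 < Abin α n := by
  refine Finset.prod_pos fun i _ => ?_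
  have : (0 : ℝ) ≤ i := Nat.cast_nonneg i
  apply div_pos <;> linarith

lemma Abin_eq_mul_Abin_sub_one (α : ℝ) (n : ℕ) :
    α * Abin α n = (α + n) * Abin (α - 1) n := by
  induction n with
  | zero => simp [Abin_zero]
  | succ n ih =>
    have hn : (n : ℝ) + 1 ≠ 0 := by positivity
    rw [Abin_succ, Abin_succ, ← mul_assoc, ih]
    push_cast
    field_simp
    ring

lemma Abin_succ_sub (α : ℝ) (n : ℕ) :
    Abin α (n + 1) - Abin α n = Abin (α - 1) (n + 1) := by
  have hn : (n : ℝ) + 1 ≠ 0 := by positivity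
  have h := Abin_eq_mul_Abin_sub_one α n
  have h2 := Abin_succ (α - 1) n
  rw [Abin_succ, h2]
  field_simp
  linear_combination h

lemma sum_Abin_sub_one (α : ℝ) (n : ℕ) :
    ∑ i ∈ Finset.range (n + 1), Abin (α - 1) i = Abin α n := by
  induction n with
  | zero => simp [Abin_zero]
  | succ n ih => rw [Finset.sum_range_succ, ih, ← Abin_succ_sub α]; ring

lemma Abin_monotone {α : ℝ} (hα : 0 < α) : Monotone (Abin α) :=
  monotone_nat_of_le_succ fun n => by
    have := Abin_succ_sub α n
    have := Abin_pos (α := α - 1) (by linarith) (n + 1)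
    linarith

lemma Abin_sub_one_antitone {α : ℝ} (hα : 0 < α) (hα1 : α ≤ 1) : Antitone (Abin (α - 1)) :=
  antitone_nat_of_succ_le fun n => by
    have hn : (0 : ℝ) < (n : ℝ) + 1 := by positivity
    rw [Abin_succ]
    refine mul_le_of_le_one_right (Abin_pos (by linarith) n).le ?_
    rw [div_le_one hn]
    linarith

lemma Abin_add_sub_le {α : ℝ} (hα : 0 < α) (hα1 : α ≤ 1) (l n : ℕ) :
    Abin α (l + n) - Abin α l ≤ Abin α n := by
  induction n with
  | zero => simp [Abin_zero]
  | succ n ih =>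
    have h1 := Abin_succ_sub α (l + n)
    have h2 := Abin_succ_sub α n
    have h3 := Abin_sub_one_antitone hα hα1 (show n + 1 ≤ l + n + 1 by omega)
    rw [← add_assoc]
    linarith

lemma rpow_le_Abin {α : ℝ} (hα : 0 < α) (hα1 : α ≤ 1) (n : ℕ) :
    ((n : ℝ) + 1) ^ α ≤ Abin α n := by
  induction n with
  | zero => simp [Abin_zero]
  | succ n ih =>
    have hn : (0 : ℝ) < (n : ℝ) + 1 := by positivity
    have h := rpow_one_add_le_one_add_mul_self (s := 1 / ((n : ℝ) + 1)) (p := α)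
      (by have : (0 : ℝ) ≤ 1 / ((n : ℝ) + 1) := by positivity
          linarith) hα.le hα1
    have e : (((n + 1 : ℕ) : ℝ) + 1) = ((n : ℝ) + 1) * (1 + 1 / ((n : ℝ) + 1)) := by
      push_cast
      field_simp
    rw [e, Real.mul_rpow hn.le (by positivity), Abin_succ]
    refine mul_le_mul ih (h.trans_eq ?_) (by positivity) (Abin_pos (by linarith) n).le
    field_simp
    ring

lemma Abin_succ_le_rpow {α : ℝ} (hα : 0 < α) (hα1 : α ≤ 1) (n : ℕ) :
    Abin α (n + 1) ≤ 2 * ((n : ℝ) + 1) ^ α := by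
  induction n with
  | zero => simp [Abin_succ, Abin_zero]; linarith
  | succ n ih =>
    have hn : (0 : ℝ) < (n : ℝ) + 1 := by positivity
    have hn2 : (0 : ℝ) < (n : ℝ) + 2 := by positivity
    have h := rpow_one_add_le_one_add_mul_self (s := -(1 / ((n : ℝ) + 2))) (p := α)
      (by rw [neg_le_neg_iff, div_le_one hn2]
          linarith [(Nat.cast_nonneg n : (0 : ℝ) ≤ n)]) hα.le hα1
    have e : ((n : ℝ) + 1) = ((n : ℝ) + 2) * (1 + -(1 / ((n : ℝ) + 2))) := by
      field_simp
      ring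
    have hs : (0 : ℝ) ≤ 1 + -(1 / ((n : ℝ) + 2)) := by
      have : 1 / ((n : ℝ) + 2) ≤ 1 := by
        rw [div_le_one hn2]
        linarith
      linarith
    rw [Abin_succ]
    have e2 : (((n + 1 : ℕ) : ℝ) + 1) = (n : ℝ) + 2 := by push_cast; ring
    have e3 : α + ((n + 1 : ℕ) : ℝ) + 1 = (n : ℝ) + 2 + α := by push_cast; ring
    rw [e2, e3]
    have hpos : (0 : ℝ) ≤ ((n : ℝ) + 2 + α) / ((n : ℝ) + 2) := by positivity
    calc Abin α (n + 1) * (((n : ℝ) + 2 + α) / ((n : ℝ) + 2))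
        ≤ 2 * ((n : ℝ) + 1) ^ α * (((n : ℝ) + 2 + α) / ((n : ℝ) + 2)) := by gcongr
      _ ≤ 2 * (((n : ℝ) + 2) ^ α * (1 + α * -(1 / ((n : ℝ) + 2)))) *
            (((n : ℝ) + 2 + α) / ((n : ℝ) + 2)) := by
          gcongr
          conv_lhs => rw [e]
          rw [Real.mul_rpow hn2.le hs]
          gcongr
      _ = 2 * ((n : ℝ) + 2) ^ α *
            ((1 + α * -(1 / ((n : ℝ) + 2))) * (((n : ℝ) + 2 + α) / ((n : ℝ) + 2))) := by ring
      _ ≤ 2 * ((n : ℝ) + 2) ^ α * 1 := by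
          gcongr
          have : (1 + α * -(1 / ((n : ℝ) + 2))) * (((n : ℝ) + 2 + α) / ((n : ℝ) + 2))
              = 1 - (α / ((n : ℝ) + 2)) ^ 2 := by
            field_simp
            ring
          rw [this]
          nlinarith [sq_nonneg (α / ((n : ℝ) + 2))]
      _ = 2 * ((n : ℝ) + 2) ^ α := mul_one _

lemma Abin_two_pow_le {α : ℝ} (hα : 0 < α) (hα1 : α ≤ 1) (j : ℕ) :
    Abin α (2 ^ j) ≤ 2 * ((2 : ℝ) ^ α) ^ j := by
  obtain ⟨k, hk⟩ : ∃ k, 2 ^ j = k + 1 := ⟨2 ^ j - 1, by have := Nat.two_pow_pos j; omega⟩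
  rw [hk]
  refine (Abin_succ_le_rpow hα hα1 k).trans_eq ?_
  have : ((k : ℝ) + 1) = (2 : ℝ) ^ j := by exact_mod_cast hk.symm
  rw [this, ← Real.rpow_natCast, ← Real.rpow_natCast, ← Real.rpow_mul (by norm_num),
    ← Real.rpow_mul (by norm_num), mul_comm α]

end CesaroNumbers

section ReversedWalsh

/-- The Walsh–Paley function of index `i < 2 ^ A` read off the reversed coordinates
`x (A - 1), x (A - 2), …, x 0`. -/
def revWalsh : ℕ → ℕ → WG → ℝ
  | 0, _, _ => 1
  | A + 1, i, x => (if i % 2 = 1 ∧ x A ≠ 0 then -1 else 1) * revWalsh A (i / 2) x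

lemma abs_revWalsh (A i : ℕ) (x : WG) : |revWalsh A i x| = 1 := by
  induction A generalizing i with
  | zero => simp [revWalsh]
  | succ A ih =>
    rw [revWalsh, abs_mul, ih, mul_one]
    split_ifs <;> simp

lemma revWalsh_zero (A : ℕ) (x : WG) : revWalsh A 0 x = 1 := by
  induction A with
  | zero => rfl
  | succ A ih => simp [revWalsh, ih]

lemma revWalsh_eq_one {A : ℕ} {x : WG} (hx : ∀ k < A, x k = 0) (i : ℕ) :
    revWalsh A i x = 1 := by
  induction A generalizing i with
  | zero => rfl
  | succ A ih =>
    rw [revWalsh, ih (fun k hk => hx k (by omega))]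
    simp [hx A (by omega)]

lemma revWalsh_two_pow_add_self (A i : ℕ) (x : WG) :
    revWalsh A (2 ^ A + i) x = revWalsh A i x := by
  induction A generalizing i with
  | zero => rfl
  | succ A ih =>
    have h1 : (2 ^ (A + 1) + i) % 2 = i % 2 := by rw [pow_succ]; omega
    have h2 : (2 ^ (A + 1) + i) / 2 = 2 ^ A + i / 2 := by rw [pow_succ]; omega
    rw [revWalsh, revWalsh, h1, h2, ih]

lemma revWalsh_two_pow_add (A m : ℕ) {i : ℕ} (hi : i < 2 ^ m) (x : WG) :
    revWalsh A (2 ^ m + i) x = revWalsh A (2 ^ m) x * revWalsh A i x := by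
  induction m generalizing A i with
  | zero =>
    obtain rfl : i = 0 := by simpa using hi
    simp [revWalsh_zero]
  | succ m ih =>
    cases A with
    | zero => simp [revWalsh]
    | succ A =>
      rw [pow_succ] at hi
      have h1 : (2 ^ (m + 1) + i) % 2 = i % 2 := by rw [pow_succ]; omega
      have h2 : (2 ^ (m + 1) + i) / 2 = 2 ^ m + i / 2 := by rw [pow_succ]; omega
      have h3 : 2 ^ (m + 1) % 2 = 0 := by rw [pow_succ]; omega
      have h4 : 2 ^ (m + 1) / 2 = 2 ^ m := by rw [pow_succ]; omega
      rw [revWalsh, revWalsh, revWalsh, h1, h2, h3, h4, ih A (by omega)]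
      simp only [zero_ne_one, false_and, if_false]
      ring

lemma revWalsh_eq_pow (A i : ℕ) (x : WG) :
    revWalsh A i x =
      (-1 : ℝ) ^ (∑ k ∈ Finset.range A, (if i.testBit k then 1 else 0) * (x (A - 1 - k)).val) := by
  induction A generalizing i with
  | zero => simp [revWalsh]
  | succ A ih =>
    rw [Finset.sum_range_succ', pow_add, revWalsh, ih, mul_comm]
    congr 1
    · congr 1
      refine Finset.sum_congr rfl fun k _ => ?_
      rw [Nat.testBit_succ, show A + 1 - 1 - (k + 1) = A - 1 - k by omega]
    · have hx : x A = 0 ∨ x A = 1 := by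
        generalize x A = z
        revert z
        decide
      have hi : i.testBit 0 = decide (i % 2 = 1) := Nat.testBit_zero i
      rcases hx with hx | hx <;> by_cases h : i % 2 = 1 <;> simp [hx, h, ZMod.val_one]

lemma kacz_two_pow_add (m : ℕ) {i : ℕ} (hi : i < 2 ^ m) (x : WG) :
    kacz (2 ^ m + i) x = rad m x * revWalsh m i x := by
  have hlog : Nat.log 2 (2 ^ m + i) = m :=
    (Nat.log_eq_iff (Or.inr ⟨by norm_num, by positivity⟩)).2 ⟨by omega, by rw [pow_succ]; omega⟩
  have hne : 2 ^ m + i ≠ 0 := by positivity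
  rw [kacz, if_neg hne, hlog, ← revWalsh_eq_pow, revWalsh_two_pow_add_self]

lemma abs_rad (m : ℕ) (x : WG) : |rad m x| = 1 := by simp [rad]

lemma abs_kacz (j : ℕ) (x : WG) : |kacz j x| = 1 := by
  unfold kacz
  split_ifs <;> simp [abs_rad]

lemma kacz_eq_one {N j : ℕ} (hj : j < 2 ^ N) {x : WG} (hx : ∀ k < N, x k = 0) :
    kacz j x = 1 := by
  rcases Nat.eq_zero_or_pos j with rfl | hpos
  · simp [kacz]
  · have hlog : Nat.log 2 j < N := Nat.log_lt_of_lt_pow hpos.ne' hj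
    obtain ⟨i, hi⟩ := Nat.exists_eq_add_of_le (Nat.pow_log_le_self 2 hpos.ne')
    have hlt := Nat.lt_pow_succ_log_self (b := 2) (by norm_num) j
    rw [pow_succ] at hlt
    rw [hi, kacz_two_pow_add _ (by omega), revWalsh_eq_one (fun k hk => hx k (by omega))]
    simp [rad, hx _ hlog]

end ReversedWalsh

section KernelWeights

/-- The weight `a ^ k`, `k` being the length of the initial run of zeros of
`x (A - 1), …, x (A - m)`. -/
def runWeight (a : ℝ) : ℕ → ℕ → WG → ℝ
  | 0, _, _ => 1
  | _ + 1, 0, _ => 1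
  | A + 1, m + 1, x => if x A = 0 then a * runWeight a A m x else 1

/-- The weight governing Cesàro kernels: with `k₁ < k₂` the positions of the first two nonzero
terms (`m` if missing) of `x (A - 1), …, x (A - m)`, it equals `(b / a) ^ k₁ * a ^ k₂`. -/
def kerWeight (a b : ℝ) : ℕ → ℕ → WG → ℝ
  | 0, _, _ => 1
  | _ + 1, 0, _ => 1
  | A + 1, m + 1, x => if x A = 0 then b * kerWeight a b A m x else a * runWeight a A m x

lemma runWeight_zero (a : ℝ) (A : ℕ) (x : WG) : runWeight a A 0 x = 1 := by
  cases A <;> rfl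

lemma kerWeight_zero (a b : ℝ) (A : ℕ) (x : WG) : kerWeight a b A 0 x = 1 := by
  cases A <;> rfl

lemma one_le_runWeight {a : ℝ} (ha : 1 ≤ a) (A m : ℕ) (x : WG) : 1 ≤ runWeight a A m x := by
  induction A generalizing m with
  | zero => simp [runWeight]
  | succ A ih =>
    cases m with
    | zero => simp [runWeight]
    | succ m =>
      rw [runWeight]
      split_ifs
      · exact one_le_mul_of_one_le_of_one_le ha (ih m)
      · exact le_rfl

lemma runWeight_le_kerWeight {a b : ℝ} (ha : 1 ≤ a) (hab : a ≤ b) (A m : ℕ) (x : WG) :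
    runWeight a A m x ≤ kerWeight a b A m x := by
  induction A generalizing m with
  | zero => simp [runWeight, kerWeight]
  | succ A ih =>
    cases m with
    | zero => simp [runWeight, kerWeight]
    | succ m =>
      rw [runWeight, kerWeight]
      have h1 := one_le_runWeight ha A m x
      split_ifs
      · exact mul_le_mul hab (ih m) (by linarith) (by linarith)
      · exact one_le_mul_of_one_le_of_one_le ha h1

lemma kerWeight_nonneg {a b : ℝ} (ha : 1 ≤ a) (hab : a ≤ b) (A m : ℕ) (x : WG) :
    0 ≤ kerWeight a b A m x :=
  zero_le_one.trans ((one_le_runWeight ha A m x).trans (runWeight_le_kerWeight ha hab A m x))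

lemma kerWeight_eq_pow {a b : ℝ} {A m : ℕ} (hm : m ≤ A) {x : WG}
    (hx : ∀ k, A - m ≤ k → k < A → x k = 0) : kerWeight a b A m x = b ^ m := by
  induction A generalizing m with
  | zero => simp [kerWeight, Nat.le_zero.1 hm]
  | succ A ih =>
    cases m with
    | zero => simp [kerWeight]
    | succ m =>
      rw [kerWeight, if_pos (hx A (by omega) (by omega)), ih (by omega)
        (fun k h1 h2 => hx k (by omega) (by omega)), pow_succ']

end KernelWeights

section ReversedSums

/-- `∑_{i < 2 ^ m} f (2 ^ m - 1 - i) w_i`, where `w_i` is the `i`-th Walsh–Paley function of the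
reversed coordinates. -/
def revSum (A m : ℕ) (f : ℕ → ℝ) (x : WG) : ℝ :=
  ∑ i ∈ Finset.range (2 ^ m), f (2 ^ m - 1 - i) * revWalsh A i x

lemma sum_range_two_mul (n : ℕ) (f : ℕ → ℝ) :
    ∑ i ∈ Finset.range (2 * n), f i = ∑ i ∈ Finset.range n, (f (2 * i) + f (2 * i + 1)) := by
  induction n with
  | zero => simp
  | succ n ih =>
    rw [mul_add, mul_one, Finset.sum_range_succ, Finset.sum_range_succ, ih,
      Finset.sum_range_succ]
    ring

lemma revSum_succ (A m : ℕ) (f : ℕ → ℝ) (x : WG) :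
    revSum (A + 1) (m + 1) f x =
      if x A = 0 then revSum A m (fun i => f (2 * i) + f (2 * i + 1)) x
      else revSum A m (fun i => f (2 * i + 1) - f (2 * i)) x := by
  have key : revSum (A + 1) (m + 1) f x = ∑ i ∈ Finset.range (2 ^ m),
      (f (2 * (2 ^ m - 1 - i) + 1) + (if x A = 0 then 1 else -1) * f (2 * (2 ^ m - 1 - i))) *
        revWalsh A i x := by
    rw [revSum, pow_succ', sum_range_two_mul]
    refine Finset.sum_congr rfl fun i hi => ?_
    have hi' := Finset.mem_range.1 hi
    have e1 : 2 * 2 ^ m - 1 - 2 * i = 2 * (2 ^ m - 1 - i) + 1 := by omega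
    have e2 : 2 * 2 ^ m - 1 - (2 * i + 1) = 2 * (2 ^ m - 1 - i) := by omega
    have e3 : (2 * i) / 2 = i := by omega
    have e4 : (2 * i + 1) / 2 = i := by omega
    rw [e1, e2, revWalsh, revWalsh, e3, e4]
    by_cases h : x A = 0 <;> simp [h] <;> ring
  rw [key]
  split_ifs <;> refine Finset.sum_congr rfl fun i _ => by ring

lemma abs_revSum_le (A m : ℕ) (f : ℕ → ℝ) (x : WG) :
    |revSum A m f x| ≤ ∑ i ∈ Finset.range (2 ^ m), |f i| := by
  rw [← Finset.sum_range_reflect]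
  refine (Finset.abs_sum_le_sum_abs _ _).trans_eq (Finset.sum_congr rfl fun i _ => ?_)
  rw [abs_mul, abs_revWalsh, mul_one]

lemma sum_sub_le_of_antitone {h : ℕ → ℝ} (hh : Antitone h) (h0 : ∀ i, 0 ≤ h i) (n : ℕ) :
    ∑ i ∈ Finset.range n, (h (2 * i) - h (2 * i + 1)) ≤ h 0 := by
  have : ∑ i ∈ Finset.range n, (h (2 * i) - h (2 * i + 1)) ≤ h 0 - h (2 * n) := by
    induction n with
    | zero => simp
    | succ n ih =>
      rw [Finset.sum_range_succ]
      have := hh (show 2 * n + 1 ≤ 2 * (n + 1) by omega)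
      linarith
  linarith [h0 (2 * n)]

lemma abs_revSum_le_of_antitone {a H : ℝ} {A m : ℕ} (hm : m ≤ A) {h : ℕ → ℝ} (hh : Antitone h)
    (h0 : ∀ i, 0 ≤ h i) (hH : ∀ j, ∑ i ∈ Finset.range (2 ^ j), h i ≤ H * a ^ j) (x : WG) :
    |revSum A m h x| ≤ H * runWeight a A m x := by
  induction A generalizing m h H with
  | zero =>
    obtain rfl : m = 0 := Nat.le_zero.1 hm
    simpa [revSum, revWalsh, runWeight, abs_of_nonneg (h0 0)] using hH 0
  | succ A ih =>
    cases m with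
    | zero => simpa [revSum, revWalsh_zero, runWeight, abs_of_nonneg (h0 0)] using hH 0
    | succ m =>
      rw [revSum_succ, runWeight]
      split_ifs with hx
      · rw [← mul_assoc]
        refine ih (by omega) (fun i j hij => ?_) (fun i => add_nonneg (h0 _) (h0 _)) fun j => ?_
        · exact add_le_add (hh (by omega)) (hh (by omega))
        · rw [← sum_range_two_mul, ← pow_succ']
          exact (hH _).trans_eq (by ring)
      · refine (abs_revSum_le _ _ _ _).trans ?_
        rw [mul_one]
        calc ∑ i ∈ Finset.range (2 ^ m), |h (2 * i + 1) - h (2 * i)|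
            = ∑ i ∈ Finset.range (2 ^ m), (h (2 * i) - h (2 * i + 1)) := by
              refine Finset.sum_congr rfl fun i _ => ?_
              have := hh (show 2 * i ≤ 2 * i + 1 by omega)
              rw [abs_of_nonpos (by linarith), neg_sub]
          _ ≤ h 0 := sum_sub_le_of_antitone hh h0 _
          _ ≤ H := by simpa using hH 0

lemma sum_sub_le_of_monotone {f : ℕ → ℝ} (hf : Monotone f) (n : ℕ) :
    ∑ i ∈ Finset.range n, (f (2 * i + 1) - f (2 * i)) ≤ f (2 * n) - f 0 := by
  induction n with
  | zero => simp
  | succ n ih =>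
    rw [Finset.sum_range_succ]
    have := hf (show 2 * n + 1 ≤ 2 * (n + 1) by omega)
    linarith

lemma abs_revSum_le_of_concave {a H : ℝ} {A m : ℕ} (hm : m ≤ A) {f : ℕ → ℝ} (hf : Monotone f)
    (hf' : Antitone fun i => f (i + 1) - f i)
    (hH : ∀ l j, f (l + 2 ^ j) - f l ≤ H * a ^ j) {x : WG}
    (hx : ∃ k, A - m ≤ k ∧ k < A ∧ x k ≠ 0) :
    |revSum A m f x| ≤ H * kerWeight a (2 * a) A m x := by
  induction A generalizing m f H with
  | zero => obtain ⟨k, -, hk, -⟩ := hx; omega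
  | succ A ih =>
    cases m with
    | zero => obtain ⟨k, h1, hk, -⟩ := hx; omega
    | succ m =>
      rw [revSum_succ, kerWeight]
      split_ifs with hxA
      · rw [← mul_assoc]
        refine ih (by omega) (fun i j hij => ?_) (fun i j hij => ?_) (fun l j => ?_) ?_
        · exact add_le_add (hf (by omega)) (hf (by omega))
        · have h1 := hf' (show 2 * i ≤ 2 * j by omega)
          have h2 := hf' (show 2 * i + 1 ≤ 2 * j + 1 by omega)
          have h3 := hf' (show 2 * i + 2 ≤ 2 * j + 2 by omega)
          simp only [mul_add, mul_one] at *
          linarith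
        · have h1 := hH (2 * l) (j + 1)
          have h2 := hH (2 * l + 1) (j + 1)
          have e1 : 2 * (l + 2 ^ j) = 2 * l + 2 ^ (j + 1) := by rw [pow_succ]; ring
          have e3 : 2 * l + 2 ^ (j + 1) + 1 = 2 * l + 1 + 2 ^ (j + 1) := by ring
          simp only [e1, e3]
          rw [pow_succ a] at h1 h2
          linarith
        · obtain ⟨k, h1, h2, h3⟩ := hx
          refine ⟨k, by omega, ?_, h3⟩
          rcases Nat.lt_succ_iff_lt_or_eq.1 h2 with h | rfl
          · exact h
          · exact absurd hxA h3
      · rw [← mul_assoc]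
        refine abs_revSum_le_of_antitone (by omega) (fun i j hij => ?_) (fun i => ?_)
          (fun j => ?_) x
        · exact hf' (show 2 * i ≤ 2 * j by omega)
        · exact sub_nonneg.2 (hf (by omega))
        · refine (sum_sub_le_of_monotone hf _).trans ?_
          have := hH 0 (j + 1)
          rw [zero_add, pow_succ'] at this
          exact this.trans_eq (by ring)

end ReversedSums

section KernelBound

lemma KK_eq_sum_kacz (α : ℝ) (n : ℕ) (x : WG) :
    KK α n x = (Abin α n)⁻¹ * ∑ j ∈ Finset.range n, Abin α (n - 1 - j) * kacz j x := by
  rw [KK]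
  congr 1
  simp only [dirK, Finset.mul_sum]
  rw [Finset.sum_comm' (t' := Finset.range n) (s' := fun j => Finset.Ico (j + 1) (n + 1))
    (by intro k j; simp only [Finset.mem_range, Finset.mem_Ico]; omega)]
  refine Finset.sum_congr rfl fun j hj => ?_
  have hj' := Finset.mem_range.1 hj
  rw [← Finset.sum_mul, Finset.sum_Ico_eq_sum_range, ← sum_Abin_sub_one,
    ← Finset.sum_range_reflect]
  congr 1
  rw [show n + 1 - (j + 1) = n - 1 - j + 1 by omega]
  refine Finset.sum_congr rfl fun i hi => ?_
  have hi' := Finset.mem_range.1 hi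
  congr 1
  omega

variable {α : ℝ}

lemma abs_revSum_Abin_le (hα : 0 < α) (hα1 : α ≤ 1) {A m : ℕ} (hm : m ≤ A) (l : ℕ) {x : WG}
    (hx : ∃ k, A - m ≤ k ∧ k < A ∧ x k ≠ 0) :
    |revSum A m (fun i => Abin α (l + i)) x| ≤ 2 * kerWeight (2 ^ α) (2 * 2 ^ α) A m x := by
  refine abs_revSum_le_of_concave hm (fun i j hij => Abin_monotone hα (by omega))
    (fun i j hij => ?_) (fun k j => ?_) hx
  · simp only [← add_assoc, Abin_succ_sub]
    exact Abin_sub_one_antitone hα hα1 (by omega)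
  · rw [← add_assoc]
    exact (Abin_add_sub_le hα hα1 _ _).trans (Abin_two_pow_le hα hα1 j)

lemma sum_Abin_add_le (hα : 0 < α) (hα1 : α ≤ 1) {m l : ℕ} (hl : l ≤ 2 ^ m) :
    ∑ i ∈ Finset.range (2 ^ m), Abin α (l + i) ≤ 4 * (2 * 2 ^ α) ^ m := by
  have ha : (2 : ℝ) ^ α ≤ 2 := by
    simpa using Real.rpow_le_rpow_of_exponent_le (by norm_num : (1 : ℝ) ≤ 2) hα1
  calc ∑ i ∈ Finset.range (2 ^ m), Abin α (l + i)
      ≤ ∑ _i ∈ Finset.range (2 ^ m), 2 * ((2 : ℝ) ^ α) ^ (m + 1) := by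
        refine Finset.sum_le_sum fun i hi => ?_
        have hi' := Finset.mem_range.1 hi
        exact (Abin_monotone hα (by rw [pow_succ]; omega)).trans
          (Abin_two_pow_le hα hα1 (m + 1))
    _ = 2 * 2 ^ α * (2 * 2 ^ α) ^ m := by
        rw [Finset.sum_const, Finset.card_range, nsmul_eq_mul, mul_pow, pow_succ]
        push_cast
        ring
    _ ≤ 4 * (2 * 2 ^ α) ^ m := by
        gcongr
        linarith

lemma one_le_two_rpow (hα : 0 < α) : (1 : ℝ) ≤ 2 ^ α :=
  Real.one_le_rpow (by norm_num) hα.le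

lemma kerWeight_two_rpow_nonneg (hα : 0 < α) (A m : ℕ) (x : WG) :
    0 ≤ kerWeight (2 ^ α) (2 * 2 ^ α) A m x :=
  kerWeight_nonneg (one_le_two_rpow hα) (by linarith [one_le_two_rpow hα]) A m x

lemma abs_revSum_Abin_le' (hα : 0 < α) (hα1 : α ≤ 1) {A m : ℕ} (hm : m ≤ A) {l : ℕ}
    (hl : l ≤ 2 ^ m) (x : WG) :
    |revSum A m (fun i => Abin α (l + i)) x| ≤ 4 * kerWeight (2 ^ α) (2 * 2 ^ α) A m x := by
  by_cases hx : ∃ k, A - m ≤ k ∧ k < A ∧ x k ≠ 0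
  · have := kerWeight_two_rpow_nonneg hα A m x
    linarith [abs_revSum_Abin_le hα hα1 hm l hx]
  · push Not at hx
    rw [kerWeight_eq_pow hm hx]
    refine (abs_revSum_le _ _ _ _).trans (le_of_eq_of_le ?_ (sum_Abin_add_le hα hα1 hl))
    exact Finset.sum_congr rfl fun i _ => abs_of_pos (Abin_pos (by linarith) _)

/-- The Walsh–Paley–Cesàro kernel in reversed coordinates. -/
lemma abs_sum_Abin_mul_revWalsh_le (hα : 0 < α) (hα1 : α ≤ 1) {A M n : ℕ} (hM : M ≤ A)
    (hn : n < 2 ^ M) (x : WG) :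
    |∑ i ∈ Finset.range n, Abin α (n - 1 - i) * revWalsh A i x| ≤
      4 * ∑ m ∈ Finset.range M, kerWeight (2 ^ α) (2 * 2 ^ α) A m x := by
  induction M generalizing n with
  | zero =>
    obtain rfl : n = 0 := by simpa using hn
    simp
  | succ M ih =>
    rw [Finset.sum_range_succ, mul_add]
    have h0 := kerWeight_two_rpow_nonneg hα A M x
    rcases lt_or_ge n (2 ^ M) with h | h
    · linarith [ih (by omega) h]
    · obtain ⟨l, rfl⟩ := Nat.exists_eq_add_of_le h
      have hl : l < 2 ^ M := by rw [pow_succ] at hn; omega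
      have e1 : ∑ i ∈ Finset.range (2 ^ M), Abin α (2 ^ M + l - 1 - i) * revWalsh A i x =
          revSum A M (fun i => Abin α (l + i)) x := by
        refine Finset.sum_congr rfl fun i hi => ?_
        have hi' := Finset.mem_range.1 hi
        rw [show 2 ^ M + l - 1 - i = l + (2 ^ M - 1 - i) by omega]
      have e2 : ∑ i ∈ Finset.range l,
          Abin α (2 ^ M + l - 1 - (2 ^ M + i)) * revWalsh A (2 ^ M + i) x =
          revWalsh A (2 ^ M) x * ∑ i ∈ Finset.range l, Abin α (l - 1 - i) * revWalsh A i x := by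
        rw [Finset.mul_sum]
        refine Finset.sum_congr rfl fun i hi => ?_
        have hi' := Finset.mem_range.1 hi
        rw [revWalsh_two_pow_add A M (by omega),
          show 2 ^ M + l - 1 - (2 ^ M + i) = l - 1 - i by omega]
        ring
      rw [Finset.sum_range_add, e1, e2]
      refine (abs_add_le _ _).trans ?_
      rw [abs_mul, abs_revWalsh, one_mul, add_comm]
      exact add_le_add (ih (by omega) hl) (abs_revSum_Abin_le' hα hα1 (by omega) hl.le x)

lemma sum_kacz_block {m n k : ℕ} (hk : k ≤ 2 ^ m) (x : WG) :
    ∑ i ∈ Finset.range k, Abin α (n - 1 - (2 ^ m + i)) * kacz (2 ^ m + i) x =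
      rad m x * ∑ i ∈ Finset.range k, Abin α (n - 1 - (2 ^ m + i)) * revWalsh m i x := by
  rw [Finset.mul_sum]
  refine Finset.sum_congr rfl fun i hi => ?_
  have hi' := Finset.mem_range.1 hi
  rw [kacz_two_pow_add m (by omega)]
  ring

lemma abs_sum_kacz_low_le (hα : 0 < α) (hα1 : α ≤ 1) {s n : ℕ} (hn : 2 ^ (s + 1) ≤ n) {x : WG}
    (hx : ∀ k < s, x k = 0) (hxs : x s ≠ 0) :
    |∑ j ∈ Finset.range (2 ^ (s + 1)), Abin α (n - 1 - j) * kacz j x| ≤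
      2 * kerWeight (2 ^ α) (2 * 2 ^ α) s s x := by
  have hrad : rad s x = -1 := by
    have : x s = 1 := by
      generalize x s = z at *
      revert z
      decide
    simp [rad, this, ZMod.val_one]
  rw [kerWeight_eq_pow le_rfl (fun k _ h => hx k h), pow_succ, mul_two, Finset.sum_range_add,
    sum_kacz_block le_rfl, hrad, Finset.mul_sum, ← Finset.sum_add_distrib]
  rw [pow_succ] at hn
  calc |∑ j ∈ Finset.range (2 ^ s), (Abin α (n - 1 - j) * kacz j x +
          -1 * (Abin α (n - 1 - (2 ^ s + j)) * revWalsh s j x))|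
      ≤ ∑ _j ∈ Finset.range (2 ^ s), 2 * ((2 : ℝ) ^ α) ^ s := by
        refine (Finset.abs_sum_le_sum_abs _ _).trans (Finset.sum_le_sum fun j hj => ?_)
        have hj' := Finset.mem_range.1 hj
        obtain ⟨l, hl⟩ : ∃ l, n = 2 ^ s + j + 1 + l := Nat.exists_eq_add_of_le (by omega)
        rw [kacz_eq_one hj' hx, revWalsh_eq_one hx,
          show n - 1 - j = l + 2 ^ s by omega, show n - 1 - (2 ^ s + j) = l by omega,
          abs_of_nonneg (by linarith [Abin_monotone hα (Nat.le_add_right l (2 ^ s))])]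
        linarith [Abin_add_sub_le hα hα1 l (2 ^ s), Abin_two_pow_le hα hα1 s]
    _ = 2 * (2 * 2 ^ α) ^ s := by
        rw [Finset.sum_const, Finset.card_range, nsmul_eq_mul, mul_pow]
        push_cast
        ring

lemma abs_sum_kacz_dyadic_le (hα : 0 < α) (hα1 : α ≤ 1) {A n : ℕ} (hn : 2 ^ A ≤ n) {x : WG}
    (hx : ∃ k < A, x k ≠ 0) :
    |∑ j ∈ Finset.range (2 ^ A), Abin α (n - 1 - j) * kacz j x| ≤
      2 * ∑ m ∈ Finset.range A, kerWeight (2 ^ α) (2 * 2 ^ α) m m x := by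
  induction A with
  | zero => obtain ⟨k, hk, -⟩ := hx; omega
  | succ A ih =>
    have hn' := hn
    rw [pow_succ] at hn'
    by_cases h : ∃ k < A, x k ≠ 0
    · have e : ∑ i ∈ Finset.range (2 ^ A), Abin α (n - 1 - (2 ^ A + i)) * revWalsh A i x =
          revSum A A (fun i => Abin α ((n - 2 ^ (A + 1)) + i)) x := by
        refine Finset.sum_congr rfl fun i hi => ?_
        have hi' := Finset.mem_range.1 hi
        rw [show n - 1 - (2 ^ A + i) = n - 2 ^ (A + 1) + (2 ^ A - 1 - i) by rw [pow_succ]; omega]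
      rw [pow_succ, mul_two, Finset.sum_range_add, sum_kacz_block le_rfl, e,
        Finset.sum_range_succ, mul_add]
      refine (abs_add_le _ _).trans ?_
      rw [abs_mul, abs_rad, one_mul]
      obtain ⟨k, hk, hxk⟩ := h
      exact add_le_add (ih (by omega) ⟨k, hk, hxk⟩)
        (abs_revSum_Abin_le hα hα1 le_rfl _ ⟨k, by omega, hk, hxk⟩)
    · push Not at h
      obtain ⟨k, hk, hxk⟩ := hx
      obtain rfl : k = A := by
        by_contra hne
        exact hxk (h k (by omega))
      refine (abs_sum_kacz_low_le hα hα1 hn h hxk).trans ?_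
      gcongr
      exact Finset.single_le_sum (f := fun m => kerWeight (2 ^ α) (2 * 2 ^ α) m m x)
        (fun m _ => kerWeight_two_rpow_nonneg hα m m x) (Finset.self_mem_range_succ k)

/-- Pointwise majorant of the Walsh–Kaczmarz–Cesàro kernels of order `A`. -/
def kerMajorant (α : ℝ) (A : ℕ) (x : WG) : ℝ :=
  ∑ m ∈ Finset.range (A + 1),
    (kerWeight (2 ^ α) (2 * 2 ^ α) m m x + kerWeight (2 ^ α) (2 * 2 ^ α) A m x)

lemma abs_KK_le (hα : 0 < α) (hα1 : α ≤ 1) {A n : ℕ} (hn : 2 ^ A ≤ n) (hn' : n < 2 ^ (A + 1))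
    (x : WG) :
    |KK α n x| ≤ 8 * (((2 : ℝ) ^ α) ^ A)⁻¹ * kerMajorant α A x := by
  have hA : ((2 : ℝ) ^ α) ^ A ≤ Abin α n := by
    refine le_trans ?_ (rpow_le_Abin hα hα1 n)
    rw [← Real.rpow_natCast, ← Real.rpow_mul (by norm_num), mul_comm, Real.rpow_mul (by norm_num)]
    gcongr
    have : ((2 ^ A : ℕ) : ℝ) ≤ n := by exact_mod_cast hn
    push_cast at this
    rw [Real.rpow_natCast]
    linarith
  have hpos : (0 : ℝ) < ((2 : ℝ) ^ α) ^ A := by positivity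
  have hw := kerWeight_two_rpow_nonneg hα
  suffices h : |∑ j ∈ Finset.range n, Abin α (n - 1 - j) * kacz j x| ≤ 8 * kerMajorant α A x by
    rw [KK_eq_sum_kacz, abs_mul, abs_inv, abs_of_pos (hpos.trans_le hA), mul_comm 8, mul_assoc]
    gcongr
  rw [kerMajorant]
  by_cases hx : ∃ k < A, x k ≠ 0
  · obtain ⟨l, rfl⟩ := Nat.exists_eq_add_of_le hn
    have hl : l < 2 ^ A := by rw [pow_succ] at hn'; omega
    have e : ∑ i ∈ Finset.range l, Abin α (2 ^ A + l - 1 - (2 ^ A + i)) * revWalsh A i x =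
        ∑ i ∈ Finset.range l, Abin α (l - 1 - i) * revWalsh A i x := by
      refine Finset.sum_congr rfl fun i _ => ?_
      rw [show 2 ^ A + l - 1 - (2 ^ A + i) = l - 1 - i by omega]
    rw [Finset.sum_range_add, sum_kacz_block hl.le, e, Finset.sum_add_distrib]
    refine (abs_add_le _ _).trans ?_
    rw [abs_mul, abs_rad, one_mul]
    have h1 := abs_sum_kacz_dyadic_le hα hα1 hn hx
    have h2 := abs_sum_Abin_mul_revWalsh_le hα hα1 le_rfl hl x
    have h3 : ∑ m ∈ Finset.range A, kerWeight (2 ^ α) (2 * 2 ^ α) m m x ≤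
        ∑ m ∈ Finset.range (A + 1), kerWeight (2 ^ α) (2 * 2 ^ α) m m x := by
      rw [Finset.sum_range_succ]
      linarith [hw A A x]
    have h4 : ∑ m ∈ Finset.range A, kerWeight (2 ^ α) (2 * 2 ^ α) A m x ≤
        ∑ m ∈ Finset.range (A + 1), kerWeight (2 ^ α) (2 * 2 ^ α) A m x := by
      rw [Finset.sum_range_succ]
      linarith [hw A A x]
    have h5 := Finset.sum_nonneg (s := Finset.range A) fun m _ => hw m m x
    have h6 := Finset.sum_nonneg (s := Finset.range A) fun m _ => hw A m x
    linarith
  · push Not at hx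
    calc |∑ j ∈ Finset.range n, Abin α (n - 1 - j) * kacz j x|
        ≤ ∑ j ∈ Finset.range n, Abin α (0 + (n - 1 - j)) := by
          refine (Finset.abs_sum_le_sum_abs _ _).trans_eq (Finset.sum_congr rfl fun j _ => ?_)
          rw [abs_mul, abs_kacz, mul_one, abs_of_pos (Abin_pos (by linarith) _), zero_add]
      _ = ∑ j ∈ Finset.range n, Abin α (0 + j) :=
          Finset.sum_range_reflect (fun j => Abin α (0 + j)) n
      _ ≤ ∑ j ∈ Finset.range (2 ^ (A + 1)), Abin α (0 + j) :=
          Finset.sum_le_sum_of_subset_of_nonneg (Finset.range_mono hn'.le)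
            fun j _ _ => (Abin_pos (by linarith) _).le
      _ ≤ 8 * (kerWeight (2 ^ α) (2 * 2 ^ α) A A x + kerWeight (2 ^ α) (2 * 2 ^ α) A A x) := by
          rw [kerWeight_eq_pow le_rfl fun k _ h => hx k h]
          refine (sum_Abin_add_le hα hα1 (Nat.zero_le _)).trans ?_
          have ha : (2 : ℝ) ^ α ≤ 2 := by
            simpa using Real.rpow_le_rpow_of_exponent_le (by norm_num : (1 : ℝ) ≤ 2) hα1
          have : (0 : ℝ) < (2 * 2 ^ α) ^ A := by positivity
          rw [pow_succ]
          nlinarith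
      _ ≤ _ := by
          gcongr
          exact Finset.single_le_sum
            (f := fun m => kerWeight (2 ^ α) (2 * 2 ^ α) m m x +
              kerWeight (2 ^ α) (2 * 2 ^ α) A m x)
            (fun m _ => add_nonneg (hw m m x) (hw A m x)) (Finset.self_mem_range_succ A)

end KernelBound

section Averaging

instance : IsProbabilityMeasure μW :=
  ⟨by
    rw [← TopologicalSpace.PositiveCompacts.coe_top (α := WG)]
    exact Measure.addHaarMeasure_self⟩

instance : (μW).IsAddHaarMeasure := by unfold μW; infer_instance

lemma measurableSet_rectW (M : ℕ) : MeasurableSet (rectW M) := by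
  have : rectW M = ⋂ i : ℕ, ⋂ _ : i < M, (fun x : WG => x i) ⁻¹' {0} := by
    ext x
    simp [rectW]
  rw [this]
  exact MeasurableSet.iInter fun i => MeasurableSet.iInter fun _ =>
    measurable_pi_apply i (measurableSet_singleton 0)

/-- The point of the Walsh group whose only nonzero coordinate is the `A`-th one. -/
def flipAt (A : ℕ) : WG := Pi.single A 1

lemma add_flipAt_of_ne {A i : ℕ} (h : i ≠ A) (x : WG) : (x + flipAt A) i = x i := by
  simp [flipAt, h]

lemma add_flipAt_self (A : ℕ) (x : WG) : (x + flipAt A) A = x A + 1 := by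
  simp [flipAt]

lemma add_flipAt_mem_rectW {A M : ℕ} (h : M ≤ A) (t : WG) :
    t + flipAt A ∈ rectW M ↔ t ∈ rectW M := by
  refine forall_congr' fun i => forall_congr' fun hi => ?_
  rw [add_flipAt_of_ne (by omega)]

lemma setLIntegral_add_flipAt {A M : ℕ} (h : M ≤ A) (F : WG → ℝ≥0∞) :
    ∫⁻ t in rectW M, F (t + flipAt A) ∂μW = ∫⁻ t in rectW M, F t ∂μW := by
  rw [← lintegral_indicator (measurableSet_rectW M), ← lintegral_indicator (measurableSet_rectW M),
    ← lintegral_add_right_eq_self ((rectW M).indicator F) (flipAt A)]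
  refine lintegral_congr fun t => ?_
  by_cases ht : t ∈ rectW M
  · rw [Set.indicator_of_mem ht, Set.indicator_of_mem ((add_flipAt_mem_rectW h t).2 ht)]
  · rw [Set.indicator_of_notMem ht,
      Set.indicator_of_notMem fun h' => ht ((add_flipAt_mem_rectW h t).1 h')]

lemma setLIntegral_le_of_add_flip_le {A M : ℕ} (h : M ≤ A) {F G : WG → ℝ≥0∞} (hF : Measurable F)
    (hG : Measurable G) (hFG : ∀ t, F t + F (t + flipAt A) ≤ 2 * G t) :
    ∫⁻ t in rectW M, F t ∂μW ≤ ∫⁻ t in rectW M, G t ∂μW := by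
  have key : 2 * ∫⁻ t in rectW M, F t ∂μW ≤ 2 * ∫⁻ t in rectW M, G t ∂μW := by
    calc 2 * ∫⁻ t in rectW M, F t ∂μW
        = ∫⁻ t in rectW M, (F t + F (t + flipAt A)) ∂μW := by
          rw [lintegral_add_left hF, setLIntegral_add_flipAt h, two_mul]
      _ ≤ ∫⁻ t in rectW M, 2 * G t ∂μW := lintegral_mono hFG
      _ = 2 * ∫⁻ t in rectW M, G t ∂μW := lintegral_const_mul _ hG
  exact (ENNReal.mul_le_mul_iff_right (by norm_num) (by norm_num)).1 key

lemma μW_rectW (M : ℕ) : μW (rectW M) = 2⁻¹ ^ M := by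
  induction M with
  | zero =>
    have : rectW 0 = Set.univ := by ext; simp [rectW]
    rw [this, measure_univ, pow_zero]
  | succ M ih =>
    have hsub : rectW (M + 1) ⊆ rectW M := fun x hx i hi => hx i (by omega)
    have hpre : rectW M \ rectW (M + 1) = (fun t => t + flipAt M) ⁻¹' rectW (M + 1) := by
      ext t
      have hz : t M + 1 = 0 ↔ t M ≠ 0 := by
        generalize t M = z
        revert z
        decide
      simp only [rectW, Set.mem_sdiff, Set.mem_ofPred_eq, Set.mem_preimage]
      constructor
      · rintro ⟨h1, h2⟩ i hi
        rcases Nat.lt_succ_iff_lt_or_eq.1 hi with h | rfl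
        · rw [add_flipAt_of_ne h.ne, h1 i h]
        · rw [add_flipAt_self, hz]
          intro h0
          refine h2 fun k hk => ?_
          rcases Nat.lt_succ_iff_lt_or_eq.1 hk with h | rfl
          exacts [h1 k h, h0]
      · intro h
        refine ⟨fun i hi => ?_, fun h' => ?_⟩
        · have := h i (by omega)
          rwa [add_flipAt_of_ne hi.ne] at this
        · have := h M (by omega)
          rw [add_flipAt_self, hz] at this
          exact this (h' M (by omega))
    have h := measure_sdiff_add_inter (μ := μW) (s := rectW M) (measurableSet_rectW (M + 1))
    rw [hpre, measure_preimage_add_right, Set.inter_eq_self_of_subset_right hsub, ih,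
      ← two_mul] at h
    rw [pow_succ', ← h, ← mul_assoc, ENNReal.inv_mul_cancel (by norm_num) (by norm_num), one_mul]

lemma measurable_runWeight (a : ℝ) (A m : ℕ) : Measurable (runWeight a A m) := by
  induction A generalizing m with
  | zero => exact measurable_const
  | succ A ih =>
    cases m with
    | zero => exact measurable_const
    | succ m =>
      exact Measurable.ite (measurable_pi_apply A (measurableSet_singleton 0))
        ((ih m).const_mul a) measurable_const

lemma measurable_kerWeight (a b : ℝ) (A m : ℕ) : Measurable (kerWeight a b A m) := by
  induction A generalizing m with
  | zero => exact measurable_const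
  | succ A ih =>
    cases m with
    | zero => exact measurable_const
    | succ m =>
      exact Measurable.ite (measurable_pi_apply A (measurableSet_singleton 0))
        ((ih m).const_mul b) ((measurable_runWeight a A m).const_mul a)

lemma runWeight_congr (a : ℝ) {A : ℕ} (m : ℕ) {x y : WG} (h : ∀ k < A, x k = y k) :
    runWeight a A m x = runWeight a A m y := by
  induction A generalizing m with
  | zero => rfl
  | succ A ih =>
    cases m with
    | zero => rfl
    | succ m => rw [runWeight, runWeight, h A (by omega), ih m fun k hk => h k (by omega)]

lemma kerWeight_congr (a b : ℝ) {A : ℕ} (m : ℕ) {x y : WG} (h : ∀ k < A, x k = y k) :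
    kerWeight a b A m x = kerWeight a b A m y := by
  induction A generalizing m with
  | zero => rfl
  | succ A ih =>
    cases m with
    | zero => rfl
    | succ m =>
      rw [kerWeight, kerWeight, h A (by omega), ih m fun k hk => h k (by omega),
        runWeight_congr a m fun k hk => h k (by omega)]

lemma runWeight_succ_add_flip (a : ℝ) (A m : ℕ) (x : WG) :
    runWeight a (A + 1) (m + 1) x + runWeight a (A + 1) (m + 1) (x + flipAt A) =
      a * runWeight a A m x + 1 := by
  have h : runWeight a A m (x + flipAt A) = runWeight a A m x :=
    runWeight_congr a m fun k hk => add_flipAt_of_ne hk.ne x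
  have hz : x A + 1 = 0 ↔ x A ≠ 0 := by
    generalize x A = z
    revert z
    decide
  rw [runWeight, runWeight, add_flipAt_self, h]
  by_cases hx : x A = 0 <;> simp [hz, hx, add_comm]

lemma kerWeight_succ_add_flip (a b : ℝ) (A m : ℕ) (x : WG) :
    kerWeight a b (A + 1) (m + 1) x + kerWeight a b (A + 1) (m + 1) (x + flipAt A) =
      b * kerWeight a b A m x + a * runWeight a A m x := by
  have h : runWeight a A m (x + flipAt A) = runWeight a A m x :=
    runWeight_congr a m fun k hk => add_flipAt_of_ne hk.ne x
  have h' : kerWeight a b A m (x + flipAt A) = kerWeight a b A m x :=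
    kerWeight_congr a b m fun k hk => add_flipAt_of_ne hk.ne x
  have hz : x A + 1 = 0 ↔ x A ≠ 0 := by
    generalize x A = z
    revert z
    decide
  rw [kerWeight, kerWeight, add_flipAt_self, h, h']
  by_cases hx : x A = 0 <;> simp [hz, hx, add_comm]

end Averaging

section Moments

lemma lintegral_le_of_add_flip_le {A : ℕ} {F G : WG → ℝ} (hF : Measurable F) (hG : Measurable G)
    (hF0 : ∀ t, 0 ≤ F t) (hFG : ∀ t, F t + F (t + flipAt A) = 2 * G t) :
    ∫⁻ t, ENNReal.ofReal (F t) ∂μW ≤ ∫⁻ t, ENNReal.ofReal (G t) ∂μW := by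
  have hu : rectW 0 = Set.univ := by ext; simp [rectW]
  have := setLIntegral_le_of_add_flip_le (Nat.zero_le A) hF.ennreal_ofReal hG.ennreal_ofReal
    (fun t => by
      rw [← ENNReal.ofReal_add (hF0 _) (hF0 _), hFG, ENNReal.ofReal_mul (by norm_num)]
      simp)
  simpa [hu] using this

lemma lintegral_runWeight_le {a : ℝ} (ha : 1 ≤ a) (ha2 : a ≤ 2) (A m : ℕ) :
    ∫⁻ x, ENNReal.ofReal (runWeight a A m x) ∂μW ≤ ENNReal.ofReal (1 + m / 2) := by
  induction A generalizing m with
  | zero =>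
    simp only [runWeight, lintegral_const, measure_univ, mul_one]
    exact ENNReal.ofReal_le_ofReal (by linarith [(Nat.cast_nonneg m : (0 : ℝ) ≤ m)])
  | succ A ih =>
    cases m with
    | zero => simp [runWeight]
    | succ m =>
      have h0 := fun x => zero_le_one.trans (one_le_runWeight ha A m x)
      calc ∫⁻ x, ENNReal.ofReal (runWeight a (A + 1) (m + 1) x) ∂μW
          ≤ ∫⁻ x, ENNReal.ofReal (a / 2 * runWeight a A m x + 1 / 2) ∂μW :=
            lintegral_le_of_add_flip_le (measurable_runWeight _ _ _)
              (((measurable_runWeight _ _ _).const_mul _).add_const _)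
              (fun x => zero_le_one.trans (one_le_runWeight ha _ _ x))
              (fun x => by rw [runWeight_succ_add_flip]; ring)
        _ = ENNReal.ofReal (a / 2) * ∫⁻ x, ENNReal.ofReal (runWeight a A m x) ∂μW +
              ENNReal.ofReal (1 / 2) := by
            rw [← lintegral_const_mul _ (measurable_runWeight _ _ _).ennreal_ofReal]
            simp_rw [ENNReal.ofReal_add (mul_nonneg (by linarith : 0 ≤ a / 2) (h0 _))
              (by norm_num : (0 : ℝ) ≤ 1 / 2), ENNReal.ofReal_mul (by linarith : 0 ≤ a / 2)]
            rw [lintegral_add_right _ measurable_const, lintegral_const, measure_univ, mul_one]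
        _ ≤ ENNReal.ofReal (a / 2) * ENNReal.ofReal (1 + m / 2) + ENNReal.ofReal (1 / 2) := by
            gcongr
            exact ih m
        _ ≤ ENNReal.ofReal (1 + (m + 1 : ℕ) / 2) := by
            rw [← ENNReal.ofReal_mul (by linarith), ← ENNReal.ofReal_add (by positivity)
              (by norm_num)]
            refine ENNReal.ofReal_le_ofReal ?_
            push_cast
            nlinarith [(Nat.cast_nonneg m : (0 : ℝ) ≤ m)]

lemma exists_lintegral_kerWeight_le {a b : ℝ} (ha : 1 ≤ a) (ha2 : a ≤ 2) (hb : 2 < b) :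
    ∃ C : ℝ, 0 ≤ C ∧ ∀ A m,
      ∫⁻ x, ENNReal.ofReal (kerWeight a b A m x) ∂μW ≤ ENNReal.ofReal (C * (b / 2) ^ m) := by
  set q := b / 2 with hq
  have hq1 : 0 < q - 1 := by rw [hq]; linarith
  set u := 1 / (2 * (q - 1)) with hu
  set v := (1 + u) / (q - 1) with hv
  have hu' : u * (q - 1) = 1 / 2 := by rw [hu]; field_simp
  have hv' : v * (q - 1) = 1 + u := by rw [hv]; field_simp
  have hu0 : 0 < u := by positivity
  have hv0 : 0 < v := by positivity
  have hnn : ∀ m : ℕ, 0 ≤ (1 + v) * q ^ m - u * m - v := fun m => by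
    have h := one_add_mul_le_pow (a := q - 1) (by linarith) m
    rw [add_sub_cancel] at h
    have hm : (0 : ℝ) ≤ m := Nat.cast_nonneg m
    have : (1 + v) * (1 + m * (q - 1)) ≤ (1 + v) * q ^ m := by gcongr
    nlinarith
  have key : ∀ A m, ∫⁻ x, ENNReal.ofReal (kerWeight a b A m x) ∂μW ≤
      ENNReal.ofReal ((1 + v) * q ^ m - u * m - v) := by
    intro A
    induction A with
    | zero =>
      intro m
      simp only [kerWeight, lintegral_const, measure_univ, mul_one]
      refine ENNReal.ofReal_le_ofReal ?_
      have h := one_add_mul_le_pow (a := q - 1) (by linarith) m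
      rw [add_sub_cancel] at h
      have hm : (0 : ℝ) ≤ m := Nat.cast_nonneg m
      have : (1 + v) * (1 + m * (q - 1)) ≤ (1 + v) * q ^ m := by gcongr
      nlinarith
    | succ A ih =>
      intro m
      cases m with
      | zero => simp [kerWeight]
      | succ m =>
        have hab : a ≤ b := by linarith
        have hm : (0 : ℝ) ≤ m := Nat.cast_nonneg m
        have h0 := fun x => zero_le_one.trans (one_le_runWeight ha A m x)
        calc ∫⁻ x, ENNReal.ofReal (kerWeight a b (A + 1) (m + 1) x) ∂μW
            ≤ ∫⁻ x, ENNReal.ofReal (q * kerWeight a b A m x + a / 2 * runWeight a A m x) ∂μW :=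
              lintegral_le_of_add_flip_le (measurable_kerWeight _ _ _ _)
                (((measurable_kerWeight _ _ _ _).const_mul _).add
                  ((measurable_runWeight _ _ _).const_mul _))
                (fun x => kerWeight_nonneg ha hab _ _ x)
                (fun x => by rw [kerWeight_succ_add_flip]; ring)
          _ = ENNReal.ofReal q * ∫⁻ x, ENNReal.ofReal (kerWeight a b A m x) ∂μW +
                ENNReal.ofReal (a / 2) * ∫⁻ x, ENNReal.ofReal (runWeight a A m x) ∂μW := by
              rw [← lintegral_const_mul _ (measurable_runWeight _ _ _).ennreal_ofReal,
                ← lintegral_const_mul _ (measurable_kerWeight _ _ _ _).ennreal_ofReal,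
                ← lintegral_add_left ((measurable_kerWeight _ _ _ _).ennreal_ofReal.const_mul _)]
              refine lintegral_congr fun x => ?_
              rw [ENNReal.ofReal_add (mul_nonneg (by linarith) (kerWeight_nonneg ha hab _ _ x))
                (mul_nonneg (by linarith) (h0 x)), ENNReal.ofReal_mul (by linarith),
                ENNReal.ofReal_mul (by linarith)]
          _ ≤ ENNReal.ofReal q * ENNReal.ofReal ((1 + v) * q ^ m - u * m - v) +
                ENNReal.ofReal (a / 2) * ENNReal.ofReal (1 + m / 2) := by
              gcongr
              · exact ih m
              · exact lintegral_runWeight_le ha ha2 A m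
          _ ≤ ENNReal.ofReal ((1 + v) * q ^ (m + 1) - u * (m + 1 : ℕ) - v) := by
              rw [← ENNReal.ofReal_mul (by linarith), ← ENNReal.ofReal_mul (by linarith),
                ← ENNReal.ofReal_add (mul_nonneg (by linarith) (hnn m)) (by positivity)]
              refine ENNReal.ofReal_le_ofReal ?_
              push_cast
              rw [pow_succ]
              have h1 : a / 2 * (1 + m / 2) ≤ 1 * (1 + (m : ℝ) / 2) := by
                gcongr
                linarith
              nlinarith
  refine ⟨1 + v, by linarith, fun A m => (key A m).trans (ENNReal.ofReal_le_ofReal ?_)⟩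
  have : (0 : ℝ) ≤ u * m := by positivity
  linarith

lemma runWeight_rpow {a : ℝ} (ha : 1 ≤ a) (p : ℝ) (A m : ℕ) (x : WG) :
    runWeight a A m x ^ p = runWeight (a ^ p) A m x := by
  induction A generalizing m with
  | zero => simp [runWeight]
  | succ A ih =>
    cases m with
    | zero => simp [runWeight]
    | succ m =>
      rw [runWeight, runWeight]
      split_ifs
      · rw [Real.mul_rpow (by linarith) (zero_le_one.trans (one_le_runWeight ha A m x)), ih]
      · exact Real.one_rpow p

lemma kerWeight_rpow {a b : ℝ} (ha : 1 ≤ a) (hab : a ≤ b) (p : ℝ) (A m : ℕ) (x : WG) :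
    kerWeight a b A m x ^ p = kerWeight (a ^ p) (b ^ p) A m x := by
  induction A generalizing m with
  | zero => simp [kerWeight]
  | succ A ih =>
    cases m with
    | zero => simp [kerWeight]
    | succ m =>
      rw [kerWeight, kerWeight]
      split_ifs
      · rw [Real.mul_rpow (by linarith) (kerWeight_nonneg ha hab A m x), ih]
      · rw [Real.mul_rpow (by linarith) (zero_le_one.trans (one_le_runWeight ha A m x)),
          runWeight_rpow ha]

lemma ENNReal_sum_rpow_le {ι : Type*} (s : Finset ι) (f : ι → ℝ≥0∞) {p : ℝ} (hp : 0 < p)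
    (hp1 : p ≤ 1) : (∑ i ∈ s, f i) ^ p ≤ ∑ i ∈ s, f i ^ p := by
  classical
  induction s using Finset.induction_on with
  | empty => simp [hp]
  | insert i s hi ih =>
    rw [Finset.sum_insert hi, Finset.sum_insert hi]
    exact (ENNReal.rpow_add_le_add_rpow _ _ hp.le hp1).trans (by gcongr)

variable {α p : ℝ}

lemma two_rpow_mul_rpow (α p : ℝ) : (2 * (2 : ℝ) ^ α) ^ p = 2 ^ ((1 + α) * p) := by
  rw [Real.rpow_mul (by norm_num), Real.rpow_add (by norm_num), Real.rpow_one]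

lemma exists_lintegral_kerMajorant_rpow_le (hα : 0 < α) (hα1 : α ≤ 1) (hp : 1 < (1 + α) * p)
    (hp1 : p ≤ 1) :
    ∃ C : ℝ≥0∞, C ≠ ⊤ ∧ ∀ M : ℕ,
      ∫⁻ x, ENNReal.ofReal (kerMajorant α M x) ^ p ∂μW ≤
        C * ENNReal.ofReal (((2 * 2 ^ α) ^ p / 2) ^ M) := by
  have hp0 : 0 < p := by
    by_contra h
    nlinarith
  have ha := one_le_two_rpow hα
  have hab : (2 : ℝ) ^ α ≤ 2 * 2 ^ α := by linarith
  set q : ℝ := (2 * 2 ^ α) ^ p / 2 with hq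
  have hb2 : 2 < (2 * (2 : ℝ) ^ α) ^ p := by
    rw [two_rpow_mul_rpow]
    simpa using Real.rpow_lt_rpow_of_exponent_lt (by norm_num : (1 : ℝ) < 2) hp
  have hq1 : 1 < q := by rw [hq]; linarith
  obtain ⟨C, hC0, hC⟩ := exists_lintegral_kerWeight_le (a := (2 ^ α) ^ p)
    (b := (2 * 2 ^ α) ^ p) (Real.one_le_rpow ha hp0.le)
    (by
      rw [← Real.rpow_mul (by norm_num)]
      simpa using Real.rpow_le_rpow_of_exponent_le (by norm_num : (1 : ℝ) ≤ 2)
        (by nlinarith : α * p ≤ 1)) hb2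
  have hw : ∀ A m, ∫⁻ x, ENNReal.ofReal (kerWeight (2 ^ α) (2 * 2 ^ α) A m x) ^ p ∂μW ≤
      ENNReal.ofReal (C * q ^ m) := fun A m => by
    refine le_trans (le_of_eq (lintegral_congr fun x => ?_)) (hC A m)
    rw [ENNReal.ofReal_rpow_of_nonneg (kerWeight_nonneg ha hab _ _ _) hp0.le,
      kerWeight_rpow ha hab]
  have hmeas := fun A m => (measurable_kerWeight (2 ^ α) (2 * 2 ^ α) A m).ennreal_ofReal.pow_const p
  refine ⟨ENNReal.ofReal (2 * C * (q / (q - 1))), ENNReal.ofReal_ne_top, fun M => ?_⟩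
  calc ∫⁻ x, ENNReal.ofReal (kerMajorant α M x) ^ p ∂μW
      ≤ ∫⁻ x, ∑ m ∈ Finset.range (M + 1),
          (ENNReal.ofReal (kerWeight (2 ^ α) (2 * 2 ^ α) m m x) ^ p +
            ENNReal.ofReal (kerWeight (2 ^ α) (2 * 2 ^ α) M m x) ^ p) ∂μW := by
        refine lintegral_mono fun x => ?_
        rw [kerMajorant, ENNReal.ofReal_sum_of_nonneg fun m _ => add_nonneg
          (kerWeight_nonneg ha hab _ _ _) (kerWeight_nonneg ha hab _ _ _)]
        refine (ENNReal_sum_rpow_le _ _ hp0 hp1).trans (Finset.sum_le_sum fun m _ => ?_)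
        rw [ENNReal.ofReal_add (kerWeight_nonneg ha hab _ _ _) (kerWeight_nonneg ha hab _ _ _)]
        exact ENNReal.rpow_add_le_add_rpow _ _ hp0.le hp1
    _ = ∑ m ∈ Finset.range (M + 1),
          (∫⁻ x, ENNReal.ofReal (kerWeight (2 ^ α) (2 * 2 ^ α) m m x) ^ p ∂μW +
            ∫⁻ x, ENNReal.ofReal (kerWeight (2 ^ α) (2 * 2 ^ α) M m x) ^ p ∂μW) := by
        refine (lintegral_finsetSum _ fun m _ => ?_).trans
          (Finset.sum_congr rfl fun m _ => lintegral_add_left (hmeas m m) _)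
        exact (hmeas m m).add (hmeas M m)
    _ ≤ ∑ m ∈ Finset.range (M + 1), ENNReal.ofReal (2 * C * q ^ m) := by
        refine Finset.sum_le_sum fun m _ => (add_le_add (hw m m) (hw M m)).trans_eq ?_
        rw [← ENNReal.ofReal_add (by positivity) (by positivity)]
        congr 1
        ring
    _ = ENNReal.ofReal (2 * C * ((q ^ (M + 1) - 1) / (q - 1))) := by
        rw [← ENNReal.ofReal_sum_of_nonneg fun m _ => by positivity, ← Finset.mul_sum,
          geom_sum_eq hq1.ne']
    _ ≤ _ := by
        have h1 : 0 < q - 1 := by linarith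
        rw [← ENNReal.ofReal_mul (by positivity)]
        refine ENNReal.ofReal_le_ofReal ?_
        rw [mul_assoc (2 * C)]
        gcongr
        rw [div_mul_eq_mul_div, pow_succ']
        gcongr
        linarith

end Moments

section DyadicAverages

lemma sum_range_le_of_recursion {J : ℕ → ℕ → ℝ≥0∞} {a c : ℝ≥0∞} {M : ℕ} (ha : 1 ≤ a)
    (hca : c + a ≤ a * c) (h1c : 1 + c ≤ a * c) (h0 : ∀ A, M ≤ A → J A 0 ≤ J M 0)
    (hs : ∀ A m, M ≤ A → J (A + 1) (m + 1) ≤ a * J A m) (t : ℕ) :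
    ∑ m ∈ Finset.range (M + t + 1), (J m m + J (M + t) m) ≤
      a ^ t * ((1 + c) * ∑ m ∈ Finset.range (M + 1), (J m m + J M m)) := by
  have hdiag : ∀ t, J (M + t) (M + t) ≤ a ^ t * J M M := by
    intro t
    induction t with
    | zero => simp
    | succ t ih =>
      calc J (M + t + 1) (M + t + 1) ≤ a * J (M + t) (M + t) := hs _ _ (by omega)
        _ ≤ a * (a ^ t * J M M) := by gcongr
        _ = _ := by rw [pow_succ', mul_assoc]
  have hu : ∀ t, ∑ m ∈ Finset.range (M + t + 1), J m m + c * J M M ≤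
      ∑ m ∈ Finset.range (M + 1), J m m + a ^ t * (c * J M M) := by
    intro t
    induction t with
    | zero => simp
    | succ t ih =>
      calc ∑ m ∈ Finset.range (M + (t + 1) + 1), J m m + c * J M M
          = (∑ m ∈ Finset.range (M + t + 1), J m m + c * J M M) + J (M + (t + 1)) (M + (t + 1)) := by
            rw [← add_assoc M t 1, Finset.sum_range_succ]
            ring
        _ ≤ (∑ m ∈ Finset.range (M + 1), J m m + a ^ t * (c * J M M)) + a ^ (t + 1) * J M M := by
            gcongr
            exact hdiag _
        _ = ∑ m ∈ Finset.range (M + 1), J m m + a ^ t * (c + a) * J M M := by ring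
        _ ≤ ∑ m ∈ Finset.range (M + 1), J m m + a ^ t * (a * c) * J M M := by gcongr
        _ = _ := by ring
  have hv : ∀ t, ∑ m ∈ Finset.range (M + t + 1), J (M + t) m + c * J M 0 ≤
      a ^ t * (∑ m ∈ Finset.range (M + 1), J M m + c * J M 0) := by
    intro t
    induction t with
    | zero => simp
    | succ t ih =>
      calc ∑ m ∈ Finset.range (M + t + 1 + 1), J (M + t + 1) m + c * J M 0
          ≤ (∑ m ∈ Finset.range (M + t + 1), a * J (M + t) m + J M 0) + c * J M 0 := by
            rw [Finset.sum_range_succ']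
            gcongr with m
            · exact hs _ _ (by omega)
            · exact h0 _ (by omega)
        _ = a * ∑ m ∈ Finset.range (M + t + 1), J (M + t) m + (1 + c) * J M 0 := by
            rw [Finset.mul_sum]
            ring
        _ ≤ a * ∑ m ∈ Finset.range (M + t + 1), J (M + t) m + (a * c) * J M 0 := by gcongr
        _ = a * (∑ m ∈ Finset.range (M + t + 1), J (M + t) m + c * J M 0) := by ring
        _ ≤ a * (a ^ t * (∑ m ∈ Finset.range (M + 1), J M m + c * J M 0)) := by gcongr
        _ = _ := by rw [pow_succ', mul_assoc]
  have hM : J M M ≤ ∑ m ∈ Finset.range (M + 1), J m m :=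
    Finset.single_le_sum (f := fun m => J m m) (fun _ _ => zero_le) (by simp)
  have hM0 : J M 0 ≤ ∑ m ∈ Finset.range (M + 1), J M m :=
    Finset.single_le_sum (f := fun m => J M m) (fun _ _ => zero_le) (by simp)
  have hat : 1 ≤ a ^ t := one_le_pow₀ ha
  rw [Finset.sum_add_distrib, Finset.sum_add_distrib]
  calc _ ≤ (∑ m ∈ Finset.range (M + 1), J m m + a ^ t * (c * J M M)) +
        a ^ t * (∑ m ∈ Finset.range (M + 1), J M m + c * J M 0) :=
        add_le_add (le_self_add.trans (hu t)) (le_self_add.trans (hv t))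
    _ ≤ (a ^ t * ∑ m ∈ Finset.range (M + 1), J m m +
          a ^ t * (c * ∑ m ∈ Finset.range (M + 1), J m m)) +
        a ^ t * (∑ m ∈ Finset.range (M + 1), J M m + c * ∑ m ∈ Finset.range (M + 1), J M m) := by
        gcongr
        exact le_mul_of_one_le_left zero_le hat
    _ = _ := by ring

/-- A majorant of `kerWeight a (2 * a)` that is almost stable under averaging over the last
coordinate when `c = a / (a - 1)`. -/
def avgWeight (a c : ℝ) (A m : ℕ) (x : WG) : ℝ :=
  kerWeight a (2 * a) A m x + c * runWeight a A m x

variable {a c : ℝ}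

lemma measurable_avgWeight (a c : ℝ) (A m : ℕ) : Measurable (avgWeight a c A m) :=
  (measurable_kerWeight _ _ _ _).add ((measurable_runWeight _ _ _).const_mul _)

lemma avgWeight_nonneg (ha : 1 ≤ a) (hc : 0 ≤ c) (A m : ℕ) (x : WG) : 0 ≤ avgWeight a c A m x :=
  add_nonneg (kerWeight_nonneg ha (by linarith) _ _ _)
    (mul_nonneg hc (zero_le_one.trans (one_le_runWeight ha A m x)))

lemma kerWeight_le_avgWeight (ha : 1 ≤ a) (hc : 0 ≤ c) (A m : ℕ) (x : WG) :
    kerWeight a (2 * a) A m x ≤ avgWeight a c A m x :=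
  le_add_of_nonneg_right (mul_nonneg hc (zero_le_one.trans (one_le_runWeight ha A m x)))

lemma avgWeight_le (ha : 1 ≤ a) (hc : 0 ≤ c) (A m : ℕ) (x : WG) :
    avgWeight a c A m x ≤ (1 + c) * kerWeight a (2 * a) A m x := by
  rw [avgWeight, add_mul, one_mul]
  gcongr
  exact runWeight_le_kerWeight ha (by linarith) A m x

lemma avgWeight_congr (a c : ℝ) {A : ℕ} (m : ℕ) {x y : WG} (h : ∀ k < A, x k = y k) :
    avgWeight a c A m x = avgWeight a c A m y := by
  rw [avgWeight, avgWeight, kerWeight_congr _ _ _ h, runWeight_congr _ _ h]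

lemma avgWeight_succ_add_flip_le (ha : 1 ≤ a) (hc : 0 ≤ c) (hac : a * c = a + c) (A m : ℕ) (x : WG) :
    avgWeight a c (A + 1) (m + 1) x + avgWeight a c (A + 1) (m + 1) (x + flipAt A) ≤
      2 * (a * avgWeight a c A m x) := by
  have hk := kerWeight_succ_add_flip a (2 * a) A m x
  have hr := runWeight_succ_add_flip a A m x
  have h1 : c * 1 ≤ c * runWeight a A m x := by
    gcongr
    exact one_le_runWeight ha A m x
  have h2 : a * c * runWeight a A m x = (a + c) * runWeight a A m x := by rw [hac]
  simp only [avgWeight]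
  linear_combination hk + c * hr + h1 - h2

lemma setLIntegral_kerWeight_le (ha : 1 < a) (hc : 0 ≤ c) (hac : a * c = a + c) (M t : ℕ) (x : WG) :
    ∫⁻ y in rectW M, ∑ m ∈ Finset.range (M + t + 1),
        (ENNReal.ofReal (kerWeight a (2 * a) m m (x + y)) +
          ENNReal.ofReal (kerWeight a (2 * a) (M + t) m (x + y))) ∂μW ≤
      ENNReal.ofReal a ^ t * (ENNReal.ofReal (1 + c) * (ENNReal.ofReal (1 + c) * (2⁻¹ ^ M *
        ∑ m ∈ Finset.range (M + 1), (ENNReal.ofReal (kerWeight a (2 * a) m m x) +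
          ENNReal.ofReal (kerWeight a (2 * a) M m x))))) := by
  set J : ℕ → ℕ → ℝ≥0∞ := fun A m =>
    ∫⁻ y in rectW M, ENNReal.ofReal (avgWeight a c A m (x + y)) ∂μW with hJ
  have hmeas : ∀ A m, Measurable fun y => ENNReal.ofReal (avgWeight a c A m (x + y)) := fun A m =>
    ((measurable_avgWeight a c A m).comp (measurable_const_add x)).ennreal_ofReal
  have hmono : ∀ A m y, ENNReal.ofReal (kerWeight a (2 * a) A m (x + y)) ≤
      ENNReal.ofReal (avgWeight a c A m (x + y)) := fun A m y =>
    ENNReal.ofReal_le_ofReal (kerWeight_le_avgWeight ha.le hc A m _)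
  have hsmall : ∀ A m, A ≤ M → J A m ≤
      ENNReal.ofReal (1 + c) * (2⁻¹ ^ M * ENNReal.ofReal (kerWeight a (2 * a) A m x)) := by
    intro A m hA
    have : J A m = ∫⁻ _ in rectW M, ENNReal.ofReal (avgWeight a c A m x) ∂μW := by
      refine setLIntegral_congr_fun (measurableSet_rectW M) fun y hy => ?_
      rw [avgWeight_congr a c m (x := x + y) (y := x) fun k hk => by
        simp [hy k (by omega)]]
    rw [this, setLIntegral_const, μW_rectW, mul_comm, mul_left_comm, ← ENNReal.ofReal_mul (by linarith)]
    gcongr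
    exact avgWeight_le ha.le hc A m x
  calc _ ≤ ∫⁻ y in rectW M, ∑ m ∈ Finset.range (M + t + 1),
        (ENNReal.ofReal (avgWeight a c m m (x + y)) +
          ENNReal.ofReal (avgWeight a c (M + t) m (x + y))) ∂μW :=
        lintegral_mono fun y => Finset.sum_le_sum fun m _ => add_le_add (hmono _ _ _) (hmono _ _ _)
    _ = ∑ m ∈ Finset.range (M + t + 1), (J m m + J (M + t) m) := by
        refine (lintegral_finsetSum _ fun m _ => ?_).trans
          (Finset.sum_congr rfl fun m _ => lintegral_add_left (hmeas m m) _)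
        exact (hmeas m m).add (hmeas (M + t) m)
    _ ≤ ENNReal.ofReal a ^ t * ((1 + ENNReal.ofReal c) *
          ∑ m ∈ Finset.range (M + 1), (J m m + J M m)) := by
        refine sum_range_le_of_recursion ?_ ?_ ?_ ?_ ?_ t
        · simpa using ha.le
        · rw [← ENNReal.ofReal_mul (by linarith), ← ENNReal.ofReal_add hc (by linarith), hac,
            add_comm]
        · rw [← ENNReal.ofReal_mul (by linarith), ← ENNReal.ofReal_one,
            ← ENNReal.ofReal_add zero_le_one hc, hac]
          exact ENNReal.ofReal_le_ofReal (by linarith)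
        · intro A _
          simp [hJ, avgWeight, kerWeight_zero, runWeight_zero]
        · intro A m hA
          rw [hJ, ← lintegral_const_mul _ (hmeas A m)]
          refine setLIntegral_le_of_add_flip_le hA (hmeas _ _) ((hmeas A m).const_mul _) fun y => ?_
          rw [← add_assoc x y, ← ENNReal.ofReal_add (avgWeight_nonneg ha.le hc _ _ _)
            (avgWeight_nonneg ha.le hc _ _ _), ← ENNReal.ofReal_mul (by linarith),
            ← ENNReal.ofReal_ofNat 2, ← ENNReal.ofReal_mul (by norm_num)]
          exact ENNReal.ofReal_le_ofReal (avgWeight_succ_add_flip_le ha.le hc hac A m _)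
    _ ≤ _ := by
        rw [← ENNReal.ofReal_one, ← ENNReal.ofReal_add zero_le_one hc]
        gcongr
        rw [Finset.mul_sum, Finset.mul_sum]
        refine Finset.sum_le_sum fun m hm => ?_
        rw [mul_add, mul_add]
        exact add_le_add (hsmall m m (by simpa [Nat.lt_succ_iff] using hm)) (hsmall M m le_rfl)

lemma ofReal_kerMajorant {α : ℝ} (hα : 0 < α) (A : ℕ) (x : WG) :
    ENNReal.ofReal (kerMajorant α A x) = ∑ m ∈ Finset.range (A + 1),
      (ENNReal.ofReal (kerWeight (2 ^ α) (2 * 2 ^ α) m m x) +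
        ENNReal.ofReal (kerWeight (2 ^ α) (2 * 2 ^ α) A m x)) := by
  have h := kerWeight_two_rpow_nonneg hα
  rw [kerMajorant, ENNReal.ofReal_sum_of_nonneg fun m _ => add_nonneg (h _ _ _) (h _ _ _)]
  exact Finset.sum_congr rfl fun m _ => ENNReal.ofReal_add (h _ _ _) (h _ _ _)

lemma exists_setLIntegral_KK_le {α : ℝ} (hα : 0 < α) (hα1 : α ≤ 1) :
    ∃ K : ℝ≥0∞, K ≠ ⊤ ∧ ∀ (M n : ℕ) (x : WG), 2 ^ M ≤ n →
      ∫⁻ y in rectW M, ENNReal.ofReal |KK α n (x + y)| ∂μW ≤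
        K * ((ENNReal.ofReal (2 ^ α) ^ M)⁻¹ * 2⁻¹ ^ M * ENNReal.ofReal (kerMajorant α M x)) := by
  set a : ℝ := 2 ^ α with ha_def
  have ha : 1 < a := Real.one_lt_rpow (by norm_num) hα
  have ha1 : 0 < a - 1 := by linarith
  set c := a / (a - 1) with hc_def
  have hc : 0 ≤ c := div_nonneg (by linarith) ha1.le
  have hac : a * c = a + c := by
    rw [hc_def]
    field_simp
    ring
  refine ⟨ENNReal.ofReal 8 * ENNReal.ofReal (1 + c) * ENNReal.ofReal (1 + c),
    by finiteness, fun M n x hn => ?_⟩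
  have hn0 : n ≠ 0 := (lt_of_lt_of_le (by positivity) hn).ne'
  obtain ⟨t, ht⟩ := Nat.exists_eq_add_of_le ((Nat.le_log_iff_pow_le (by norm_num) hn0).2 hn)
  have h1 : 2 ^ (M + t) ≤ n := ht ▸ Nat.pow_log_le_self 2 hn0
  have h2 : n < 2 ^ (M + t + 1) := ht ▸ Nat.lt_pow_succ_log_self (by norm_num) n
  have ha0 : ENNReal.ofReal a ≠ 0 := by simpa using by linarith
  calc ∫⁻ y in rectW M, ENNReal.ofReal |KK α n (x + y)| ∂μW
      ≤ ∫⁻ y in rectW M, ENNReal.ofReal (8 * (a ^ (M + t))⁻¹) *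
          ENNReal.ofReal (kerMajorant α (M + t) (x + y)) ∂μW := by
        refine lintegral_mono fun y => ?_
        rw [← ENNReal.ofReal_mul (by positivity)]
        exact ENNReal.ofReal_le_ofReal (abs_KK_le hα hα1 h1 h2 _)
    _ = ENNReal.ofReal (8 * (a ^ (M + t))⁻¹) *
          ∫⁻ y in rectW M, ENNReal.ofReal (kerMajorant α (M + t) (x + y)) ∂μW :=
        lintegral_const_mul' _ _ ENNReal.ofReal_ne_top
    _ ≤ ENNReal.ofReal (8 * (a ^ (M + t))⁻¹) * (ENNReal.ofReal a ^ t * (ENNReal.ofReal (1 + c) *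
          (ENNReal.ofReal (1 + c) * (2⁻¹ ^ M * ENNReal.ofReal (kerMajorant α M x))))) := by
        simp only [ofReal_kerMajorant hα]
        gcongr
        exact setLIntegral_kerWeight_le ha hc hac M t x
    _ = ENNReal.ofReal 8 * (ENNReal.ofReal (a ^ (M + t))⁻¹ * ENNReal.ofReal a ^ t) *
          ENNReal.ofReal (1 + c) * ENNReal.ofReal (1 + c) *
          (2⁻¹ ^ M * ENNReal.ofReal (kerMajorant α M x)) := by
        rw [ENNReal.ofReal_mul (by norm_num)]
        ring
    _ = _ := by
        have : ENNReal.ofReal (a ^ (M + t))⁻¹ * ENNReal.ofReal a ^ t = (ENNReal.ofReal a ^ M)⁻¹ := by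
          rw [ENNReal.ofReal_inv_of_pos (by positivity), ENNReal.ofReal_pow (by linarith), pow_add,
            ENNReal.mul_inv (by simp [ha0]) (by simp), mul_assoc, ENNReal.inv_mul_cancel
              (pow_ne_zero _ ha0) (by finiteness), mul_one]
        rw [this]
        ring

end DyadicAverages

section AverageMajorant

variable {α p : ℝ}

lemma exists_majorant_setLIntegral_KK (hα : 0 < α) (hα1 : α ≤ 1) (hp : 1 < (1 + α) * p)
    (hp1 : p ≤ 1) :
    ∃ (Φ : ℕ → WG → ℝ≥0∞) (C : ℝ≥0∞), C ≠ ⊤ ∧ (∀ M, Measurable (Φ M)) ∧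
      (∀ M n x, 2 ^ M ≤ n → ∫⁻ y in rectW M, ENNReal.ofReal |KK α n (x + y)| ∂μW ≤ Φ M x) ∧
      ∀ M, ∫⁻ x, Φ M x ^ p ∂μW ≤ C * 2⁻¹ ^ M := by
  have hp0 : 0 < p := by
    by_contra h
    nlinarith
  obtain ⟨K, hK, hKK⟩ := exists_setLIntegral_KK_le hα hα1
  obtain ⟨C, hC, hCM⟩ := exists_lintegral_kerMajorant_rpow_le hα hα1 hp hp1
  have hmeas : ∀ M, Measurable (kerMajorant α M) := fun M =>
    Finset.measurable_sum _ fun m _ =>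
      (measurable_kerWeight _ _ _ _).add (measurable_kerWeight _ _ _ _)
  refine ⟨_, K ^ p * C, ENNReal.mul_ne_top (ENNReal.rpow_ne_top_of_nonneg hp0.le hK) hC,
    fun M => ((hmeas M).ennreal_ofReal.const_mul _).const_mul _, hKK, fun M => ?_⟩
  set b : ℝ := 2 * 2 ^ α with hb
  have hb0 : 0 < b := by positivity
  have hbM : (ENNReal.ofReal (2 ^ α) ^ M)⁻¹ * 2⁻¹ ^ M = ENNReal.ofReal ((b ^ M)⁻¹) := by
    rw [ENNReal.ofReal_inv_of_pos (by positivity), ENNReal.ofReal_pow hb0.le, hb,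
      ENNReal.ofReal_mul (by norm_num), ENNReal.ofReal_ofNat, mul_pow,
      ENNReal.mul_inv (by simp) (by simp), ENNReal.inv_pow (a := 2), mul_comm]
  calc ∫⁻ x, (K * ((ENNReal.ofReal (2 ^ α) ^ M)⁻¹ * 2⁻¹ ^ M *
          ENNReal.ofReal (kerMajorant α M x))) ^ p ∂μW
      = ∫⁻ x, K ^ p * ENNReal.ofReal (((b ^ M)⁻¹) ^ p) *
          ENNReal.ofReal (kerMajorant α M x) ^ p ∂μW := by
        refine lintegral_congr fun x => ?_
        rw [hbM, ENNReal.mul_rpow_of_nonneg _ _ hp0.le, ENNReal.mul_rpow_of_nonneg _ _ hp0.le,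
          ENNReal.ofReal_rpow_of_nonneg (by positivity) hp0.le, mul_assoc]
    _ = K ^ p * ENNReal.ofReal (((b ^ M)⁻¹) ^ p) *
          ∫⁻ x, ENNReal.ofReal (kerMajorant α M x) ^ p ∂μW :=
        lintegral_const_mul _ ((hmeas M).ennreal_ofReal.pow_const p)
    _ ≤ K ^ p * ENNReal.ofReal (((b ^ M)⁻¹) ^ p) * (C * ENNReal.ofReal ((b ^ p / 2) ^ M)) := by
        gcongr
        exact hCM M
    _ = K ^ p * C * ENNReal.ofReal (((b ^ M)⁻¹) ^ p * (b ^ p / 2) ^ M) := by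
        rw [ENNReal.ofReal_mul (by positivity)]
        ring
    _ = K ^ p * C * 2⁻¹ ^ M := by
        congr 1
        have : ((b ^ M)⁻¹) ^ p * (b ^ p / 2) ^ M = (2⁻¹ : ℝ) ^ M := by
          rw [Real.inv_rpow (by positivity), ← Real.rpow_pow_comm hb0.le, div_pow, inv_pow]
          field_simp
        rw [this, ENNReal.ofReal_pow (by norm_num), ENNReal.ofReal_inv_of_pos (by norm_num),
          ENNReal.ofReal_ofNat]

end AverageMajorant

section ProductMeasure

lemma lintegral_pi_prod {ι : Type*} [Fintype ι] {X : ι → Type*} [∀ i, MeasurableSpace (X i)]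
    (μ : ∀ i, Measure (X i)) [∀ i, IsProbabilityMeasure (μ i)] {f : ∀ i, X i → ℝ≥0∞}
    (hf : ∀ i, Measurable (f i)) :
    ∫⁻ x, ∏ i, f i (x i) ∂(Measure.pi μ) = ∏ i, ∫⁻ y, f i y ∂(μ i) := by
  have hind := ProbabilityTheory.iIndepFun_pi (μ := μ) (X := f) fun i => (hf i).aemeasurable
  rw [ProbabilityTheory.lintegral_prod_eq_prod_lintegral_of_indepFun Finset.univ _ hind
    fun i => (hf i).comp (measurable_pi_apply i)]
  exact Finset.prod_congr rfl fun i _ => (measurePreserving_eval μ i).lintegral_comp (hf i)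

instance (d : ℕ) : IsProbabilityMeasure (μD d) := by unfold μD; infer_instance

lemma rectAt_zero_eq_pi (d : ℕ) (N : Fin d → ℕ) :
    rectAt d N 0 = Set.univ.pi fun i => rectW (N i) := by
  ext x
  simp [rectAt, rectW]

lemma measurableSet_rectAt_zero (d : ℕ) (N : Fin d → ℕ) : MeasurableSet (rectAt d N 0) := by
  rw [rectAt_zero_eq_pi]
  exact MeasurableSet.univ_pi fun i => measurableSet_rectW (N i)

lemma μD_rectAt_zero (d : ℕ) (N : Fin d → ℕ) : μD d (rectAt d N 0) = ∏ i, 2⁻¹ ^ N i := by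
  rw [rectAt_zero_eq_pi, μD, Measure.pi_pi]
  exact Finset.prod_congr rfl fun i _ => μW_rectW (N i)

lemma setLIntegral_rectAt_prod (d : ℕ) (N : Fin d → ℕ) {f : Fin d → WG → ℝ≥0∞}
    (hf : ∀ i, Measurable (f i)) :
    ∫⁻ t in rectAt d N 0, ∏ i, f i (t i) ∂μD d = ∏ i, ∫⁻ y in rectW (N i), f i y ∂μW := by
  rw [← lintegral_indicator (measurableSet_rectAt_zero d N)]
  simp_rw [← lintegral_indicator (measurableSet_rectW _)]
  rw [μD, ← lintegral_pi_prod _ fun i => (hf i).indicator (measurableSet_rectW (N i))]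
  refine lintegral_congr fun t => ?_
  by_cases h : t ∈ rectAt d N 0
  · rw [Set.indicator_of_mem h]
    exact Finset.prod_congr rfl fun i _ => (Set.indicator_of_mem (s := rectW (N i)) (h i) _).symm
  · rw [Set.indicator_of_notMem h]
    rw [rectAt_zero_eq_pi, Set.mem_univ_pi, not_forall] at h
    obtain ⟨i, hi⟩ := h
    exact (Finset.prod_eq_zero (Finset.mem_univ i) (Set.indicator_of_notMem hi _)).symm

end ProductMeasure

section KernelRepresentation

lemma rad_add (k : ℕ) (x y : WG) : rad k (x + y) = rad k x * rad k y := by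
  have key : ∀ u v : ZMod 2, (-1 : ℝ) ^ (u + v).val = (-1 : ℝ) ^ u.val * (-1) ^ v.val := by
    intro u v
    rw [← pow_add, neg_one_pow_eq_pow_mod_two (R := ℝ) (u.val + v.val), ZMod.val_add]
  exact key _ _

lemma kacz_eq_prod_rad {n : ℕ} (hn : n ≠ 0) (x : WG) :
    kacz n x = rad (Nat.log 2 n) x * ∏ k ∈ Finset.range (Nat.log 2 n),
      if n.testBit k then rad (Nat.log 2 n - 1 - k) x else 1 := by
  rw [kacz, if_neg hn, ← Finset.prod_pow_eq_pow_sum]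
  congr 1
  refine Finset.prod_congr rfl fun k _ => ?_
  split_ifs <;> simp [rad]

lemma kacz_add (n : ℕ) (x y : WG) : kacz n (x + y) = kacz n x * kacz n y := by
  by_cases hn : n = 0
  · simp [kacz, hn]
  · rw [kacz_eq_prod_rad hn, kacz_eq_prod_rad hn, kacz_eq_prod_rad hn, rad_add,
      mul_mul_mul_comm, ← Finset.prod_mul_distrib]
    congr 1
    refine Finset.prod_congr rfl fun k _ => ?_
    split_ifs
    · exact rad_add _ _ _
    · simp

lemma measurable_rad (k : ℕ) : Measurable (rad k) :=
  (Measurable.of_discrete (f := fun u : ZMod 2 => (-1 : ℝ) ^ u.val)).comp (measurable_pi_apply k)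

lemma measurable_kacz (n : ℕ) : Measurable (kacz n) := by
  by_cases hn : n = 0
  · simp only [funext fun x => show kacz n x = 1 by simp [kacz, hn]]
    exact measurable_const
  · rw [funext (kacz_eq_prod_rad hn)]
    refine (measurable_rad _).mul (Finset.measurable_prod _ fun k _ => ?_)
    split_ifs
    · exact measurable_rad _
    · exact measurable_const

lemma measurable_KK (α : ℝ) (n : ℕ) : Measurable (KK α n) :=
  (Finset.measurable_sum _ fun _ _ =>
    (Finset.measurable_sum _ fun k _ => measurable_kacz k).const_mul _).const_mul _

lemma measurable_kaczD (d : ℕ) (m : Fin d → ℕ) : Measurable (kaczD d m) :=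
  Finset.measurable_prod _ fun i _ => (measurable_kacz (m i)).comp (measurable_pi_apply i)

lemma abs_kaczD (d : ℕ) (m : Fin d → ℕ) (x : Fin d → WG) : |kaczD d m x| = 1 := by
  rw [kaczD, Finset.abs_prod]
  exact Finset.prod_eq_one fun i _ => abs_kacz _ _

lemma kaczD_add (d : ℕ) (m : Fin d → ℕ) (x t : Fin d → WG) :
    kaczD d m (x + t) = kaczD d m x * kaczD d m t := by
  simp only [kaczD, Pi.add_apply, kacz_add, Finset.prod_mul_distrib]

lemma prod_KK_eq_sum (d : ℕ) (α : Fin d → ℝ) (n : Fin d → ℕ) (x : Fin d → WG) :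
    ∏ i, KK (α i) (n i) (x i) = (∏ i, Abin (α i) (n i))⁻¹ *
      ∑ k ∈ Fintype.piFinset fun i => Finset.range (n i + 1),
        (∏ i, Abin (α i - 1) (n i - k i)) *
          ∑ m ∈ Fintype.piFinset fun i => Finset.range (k i), kaczD d m x := by
  simp only [KK, Finset.prod_mul_distrib, Finset.prod_inv_distrib, dirK, kaczD]
  rw [Finset.prod_univ_sum]
  simp only [Finset.prod_mul_distrib]
  congr 1
  refine Finset.sum_congr rfl fun k _ => ?_
  rw [Finset.prod_univ_sum]

lemma cesaroOf_fCoeff_eq_integral (d : ℕ) (α : Fin d → ℝ) (n : Fin d → ℕ)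
    {f : (Fin d → WG) → ℝ} (hf : Integrable f (μD d)) (x : Fin d → WG) :
    cesaroOf d α (fCoeff d f) n x = ∫ t, f t * ∏ i, KK (α i) (n i) (x i + t i) ∂μD d := by
  have hint : ∀ m, Integrable (fun t => f t * kaczD d m t) (μD d) := fun m =>
    hf.mul_bdd (c := 1) (measurable_kaczD d m).aestronglyMeasurable
      (Filter.Eventually.of_forall fun t => by rw [Real.norm_eq_abs, abs_kaczD])
  have h : ∀ t, f t * ∏ i, KK (α i) (n i) (x i + t i) = (∏ i, Abin (α i) (n i))⁻¹ *
      ∑ k ∈ Fintype.piFinset fun i => Finset.range (n i + 1),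
        (∏ i, Abin (α i - 1) (n i - k i)) *
          ∑ m ∈ Fintype.piFinset fun i => Finset.range (k i),
            f t * kaczD d m t * kaczD d m x := by
    intro t
    rw [show ∏ i, KK (α i) (n i) (x i + t i) = ∏ i, KK (α i) (n i) ((x + t) i) from rfl,
      prod_KK_eq_sum, mul_left_comm]
    congr 1
    rw [Finset.mul_sum]
    refine Finset.sum_congr rfl fun k _ => ?_
    rw [mul_left_comm, Finset.mul_sum (a := f t)]
    congr 1
    refine Finset.sum_congr rfl fun m _ => ?_
    rw [kaczD_add]
    ring
  simp only [h]
  rw [integral_const_mul, integral_finsetSum _ fun k _ => (integrable_finsetSum _ fun m _ =>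
    (hint m).mul_const _).const_mul _]
  simp only [integral_const_mul]
  rw [cesaroOf]
  congr 1
  refine Finset.sum_congr rfl fun k _ => ?_
  rw [integral_finsetSum _ fun m _ => (hint m).mul_const _]
  simp only [integral_mul_const]
  rfl

end KernelRepresentation

section Cone

lemma IsCRF.pow_mul_le {d : ℕ} [NeZero d] {γ : Fin d → ℝ → ℝ} {ζ c₁ c₂ : ℝ} {j : Fin d}
    (hζ : 1 ≤ ζ) (hc₁ : 0 ≤ c₁) (hc₂ : 0 ≤ c₂)
    (h : ∀ x : ℝ, 1 ≤ x → c₁ * γ j x ≤ γ j (ζ * x) ∧ γ j (ζ * x) ≤ c₂ * γ j x)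
    (k : ℕ) {x : ℝ} (hx : 1 ≤ x) :
    c₁ ^ k * γ j x ≤ γ j (ζ ^ k * x) ∧ γ j (ζ ^ k * x) ≤ c₂ ^ k * γ j x := by
  induction k with
  | zero => simp
  | succ k ih =>
    have hk : 1 ≤ ζ ^ k * x := one_le_mul_of_one_le_of_one_le (one_le_pow₀ hζ) hx
    obtain ⟨h1, h2⟩ := h _ hk
    rw [pow_succ', mul_assoc, pow_succ', mul_assoc, pow_succ', mul_assoc]
    exact ⟨(mul_le_mul_of_nonneg_left ih.1 hc₁).trans h1,
      h2.trans (mul_le_mul_of_nonneg_left ih.2 hc₂)⟩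

lemma exists_coneLike_two_pow_le {d : ℕ} [NeZero d] {γ : Fin d → ℝ → ℝ} (hγ : IsCRF d γ)
    (β : Fin d → ℝ) (hβ : ∀ j, j ≠ 0 → 1 ≤ β j) :
    ∃ r : ℕ, ∀ N : Fin d → ℕ,
      (∀ j, j ≠ 0 → (2 : ℝ) ^ N j ≤ γ j (2 ^ N 0) ∧ γ j (2 ^ N 0) < (2 : ℝ) ^ (N j + 1)) →
      ∀ n ∈ coneLike d γ β, n 0 ≠ 0 → (∃ j, 2 ^ N j < n j) → ∀ i, 2 ^ (N i - r) ≤ n i := by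
  obtain ⟨ζ, hζ, hreg⟩ := hγ.reg
  choose! c₁ c₂ hc₁ hc₂ hc using hreg
  have hk : ∀ᶠ k in atTop, ∀ j : Fin d, j ≠ 0 → 2 * β j ≤ c₁ j ^ k := by
    refine eventually_all.2 fun j => ?_
    by_cases hj : j = 0
    · simp [hj]
    · filter_upwards [(tendsto_pow_atTop_atTop_of_one_lt (hc₁ j hj)).eventually_ge_atTop (2 * β j)]
        with k hk _ using hk
  obtain ⟨k, hk⟩ := hk.exists
  have htwo := tendsto_pow_atTop_atTop_of_one_lt (one_lt_two (α := ℝ))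
  have hr : ∀ᶠ r in atTop, ζ ^ k ≤ (2 : ℝ) ^ r ∧ ∀ j : Fin d, β j * c₂ j ^ k ≤ (2 : ℝ) ^ r :=
    (htwo.eventually_ge_atTop _).and (eventually_all.2 fun j => htwo.eventually_ge_atTop _)
  obtain ⟨r, hrζ, hrβ⟩ := hr.exists
  refine ⟨r, fun N hN n hn hn0 ⟨j, hj⟩ i => ?_⟩
  have hn1 : (1 : ℝ) ≤ n 0 := by exact_mod_cast Nat.one_le_iff_ne_zero.2 hn0
  have hζk : 1 ≤ ζ ^ k := one_le_pow₀ hζ.le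
  have hζn : 1 ≤ ζ ^ k * n 0 := one_le_mul_of_one_le_of_one_le hζk hn1
  have hX1 : (1 : ℝ) ≤ 2 ^ N 0 := one_le_pow₀ one_le_two
  have hpow := fun (j : Fin d) (hj : j ≠ 0) => IsCRF.pow_mul_le hζ.le
    (zero_le_one.trans (hc₁ j hj).le) (zero_le_one.trans (hc₂ j hj).le) (hc j hj) k hn1
  have hX : (2 : ℝ) ^ N 0 ≤ ζ ^ k * n 0 := by
    have hj' : (2 : ℝ) ^ N j < n j := by exact_mod_cast hj
    by_cases hj0 : j = 0
    · subst hj0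
      exact hj'.le.trans (le_mul_of_one_le_left (by linarith) hζk)
    · by_contra! hlt
      have h1 := hγ.strictMono j hj0 hζn hX1 hlt
      have h2 := (hpow j hj0).1
      have h3 := (hN j hj0).2
      have h4 := (hn j hj0).2
      have h5 : 2 * β j * γ j (n 0) ≤ c₁ j ^ k * γ j (n 0) := by
        gcongr
        · exact zero_le_one.trans (hγ.one_le j hj0 _ hn1)
        · exact hk j hj0
      rw [pow_succ] at h3
      linarith
  have hdiv : ∀ y : ℝ, (2 : ℝ) ^ N i ≤ 2 ^ r * y → 1 ≤ y → (2 : ℝ) ^ (N i - r) ≤ y := by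
    intro y hy hy1
    rcases le_total r (N i) with h | h
    · rw [← Nat.add_sub_of_le h, pow_add] at hy
      exact le_of_mul_le_mul_left hy (by positivity)
    · simpa [Nat.sub_eq_zero_of_le h] using hy1
  have hreal : (2 : ℝ) ^ (N i - r) ≤ n i := by
    by_cases hi : i = 0
    · subst hi
      exact hdiv _ (hX.trans (by gcongr)) hn1
    · have hβi : 0 < β i := zero_lt_one.trans_le (hβ i hi)
      have hγn := hγ.one_le i hi _ hn1
      have hni : γ i (n 0) ≤ β i * n i := by
        have := (hn i hi).1
        rwa [inv_mul_le_iff₀ hβi] at this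
      have hpos : (1 : ℝ) ≤ n i := by
        have : (0 : ℝ) < n i := pos_of_mul_pos_right (by linarith) hβi.le
        exact_mod_cast this
      refine hdiv _ ?_ hpos
      have h0 : 0 ≤ c₂ i ^ k := pow_nonneg (zero_le_one.trans (hc₂ i hi).le) k
      calc (2 : ℝ) ^ N i ≤ γ i (2 ^ N 0) := (hN i hi).1
        _ ≤ γ i (ζ ^ k * n 0) := (hγ.strictMono i hi).monotoneOn hX1 hζn hX
        _ ≤ c₂ i ^ k * γ i (n 0) := (hpow i hi).2
        _ ≤ c₂ i ^ k * (β i * n i) := by gcongr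
        _ = β i * c₂ i ^ k * n i := by ring
        _ ≤ 2 ^ r * n i := by
          gcongr
          exact hrβ i
  exact_mod_cast hreal

end Cone

section Atoms

variable {d : ℕ} {p : ℝ} {a : (Fin d → WG) → ℝ} {N : Fin d → ℕ}

lemma IsPAtom.integrable {y : Fin d → WG} (ha : IsPAtom d p a N y) : Integrable a (μD d) :=
  Integrable.of_bound ha.measurable.aestronglyMeasurable _ (Filter.Eventually.of_forall ha.bound)

lemma IsPAtom.fCoeff_eq_zero (ha : IsPAtom d p a N 0) {m : Fin d → ℕ} (hm : ∀ i, m i < 2 ^ N i) :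
    fCoeff d a m = 0 := by
  rw [fCoeff, ← ha.zero]
  refine integral_congr_ae (Filter.Eventually.of_forall fun x => ?_)
  by_cases hx : x ∈ rectAt d N 0
  · have : kaczD d m x = 1 := Finset.prod_eq_one fun i _ => kacz_eq_one (hm i) (hx i)
    simp [this]
  · simp [ha.support x hx]

lemma IsPAtom.cesaroOf_eq_zero (ha : IsPAtom d p a N 0) (α : Fin d → ℝ) {n : Fin d → ℕ}
    (hn : ∀ m : Fin d → ℕ, (∀ i, m i < n i) → ∀ i, m i < 2 ^ N i) (x : Fin d → WG) :
    cesaroOf d α (fCoeff d a) n x = 0 := by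
  rw [cesaroOf, Finset.sum_eq_zero fun k hk => ?_, mul_zero]
  rw [partialSumOf, Finset.sum_eq_zero fun m hm => ?_, mul_zero]
  rw [ha.fCoeff_eq_zero (hn m fun i => ?_), zero_mul]
  have hki := Finset.mem_range.1 (Fintype.mem_piFinset.1 hk i)
  have hmi := Finset.mem_range.1 (Fintype.mem_piFinset.1 hm i)
  omega

lemma rectW_anti {M N : ℕ} (h : M ≤ N) : rectW N ⊆ rectW M :=
  fun _ hx i hi => hx i (hi.trans_le h)

lemma IsPAtom.abs_cesaroOf_le (ha : IsPAtom d p a N 0) (α : Fin d → ℝ) (n : Fin d → ℕ)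
    (x : Fin d → WG) :
    ENNReal.ofReal |cesaroOf d α (fCoeff d a) n x| ≤
      ENNReal.ofReal ((μD d (rectAt d N 0)).toReal ^ (-(1 / p))) *
        ∏ i, ∫⁻ y in rectW (N i), ENNReal.ofReal |KK (α i) (n i) (x i + y)| ∂μW := by
  have hmeas : ∀ i, Measurable fun y => ENNReal.ofReal |KK (α i) (n i) (x i + y)| := fun i =>
    ((measurable_KK _ _).comp (measurable_const_add (x i))).norm.ennreal_ofReal
  rw [cesaroOf_fCoeff_eq_integral d α n ha.integrable, ← setLIntegral_rectAt_prod d N hmeas,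
    ← lintegral_const_mul' _ _ ENNReal.ofReal_ne_top,
    ← lintegral_indicator (measurableSet_rectAt_zero d N), ← Real.norm_eq_abs,
    ofReal_norm]
  refine (enorm_integral_le_lintegral_enorm _).trans (lintegral_mono fun t => ?_)
  by_cases ht : t ∈ rectAt d N 0
  · rw [Set.indicator_of_mem ht, ← ENNReal.ofReal_prod_of_nonneg fun _ _ => abs_nonneg _,
      ← Finset.abs_prod, ← ENNReal.ofReal_mul (by positivity), ← ofReal_norm,
      Real.norm_eq_abs, abs_mul]
    gcongr
    exact ha.bound t
  · simp [ha.support t ht]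

end Atoms

/-- the maximal operator `σ_L^{κ,α,*}` is `p`-quasilocal in the modified
sense: there are `r ∈ ℕ` and `c_p` such that for every `p`-atom `a` supported on
`I = I_{N_1} × ⋯ × I_{N_d}` (with `2^{N_j} ≤ γ_j(2^{N_1}) < 2^{N_j+1}` and `N_j ≥ r`),
`∫_{(I^r)ᶜ} |σ_L^{κ,α,*}a|^p dμ ≤ c_p`, where `I^r = I_{N_1-r} × ⋯ × I_{N_d-r}`. -/
theorem cesaroMaximal_quasilocal
    (d : ℕ) (α : Fin (d + 1) → ℝ) (hα : ∀ i, 0 < α i ∧ α i ≤ 1)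
    (γ : Fin (d + 1) → ℝ → ℝ) (hγ : IsCRF (d + 1) γ)
    (β : Fin (d + 1) → ℝ) (hβ : ∀ j : Fin (d + 1), j ≠ 0 → 1 ≤ β j)
    (p : ℝ) (hp₁ : Finset.univ.sup' Finset.univ_nonempty (fun i => 1 / (1 + α i)) < p)
    (hp₂ : p ≤ 1) :
    ∃ r : ℕ, ∃ C : ℝ≥0∞, C ≠ ⊤ ∧
      ∀ N : Fin (d + 1) → ℕ,
        (∀ j : Fin (d + 1), j ≠ 0 →
          (2 : ℝ) ^ (N j) ≤ γ j ((2 : ℝ) ^ (N 0)) ∧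
            γ j ((2 : ℝ) ^ (N 0)) < (2 : ℝ) ^ (N j + 1)) →
        (∀ j, r ≤ N j) →
        ∀ a : (Fin (d + 1) → WG) → ℝ, IsPAtom (d + 1) p a N 0 →
          ∫⁻ x in (rectAt (d + 1) (fun j => N j - r) 0)ᶜ,
              (cesaroMaximal (d + 1) α γ β (fCoeff (d + 1) a) x) ^ p ∂ μD (d + 1) ≤ C := by
  have hp : ∀ i, 1 < (1 + α i) * p := fun i => by
    have := (Finset.sup'_lt_iff _).1 hp₁ i (Finset.mem_univ i)
    rwa [div_lt_iff₀' (by linarith [(hα i).1])] at this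
  have hp0 : 0 < p := by
    have := hp 0
    by_contra h
    nlinarith [(hα 0).1]
  choose Φ C hC hΦm hΦ hΦint using fun i =>
    exists_majorant_setLIntegral_KK (hα i).1 (hα i).2 (hp i) hp₂
  obtain ⟨r, hr⟩ := exists_coneLike_two_pow_le hγ β hβ
  refine ⟨r, ∏ i, C i * 2 ^ r, ENNReal.prod_ne_top fun i _ =>
    ENNReal.mul_ne_top (hC i) (by finiteness), fun N hN hNr a ha => ?_⟩
  set u : ℝ≥0∞ := ∏ i, 2⁻¹ ^ N i with hu
  have hu0 : u ≠ 0 := Finset.prod_ne_zero_iff.2 fun i _ => by simp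
  have hutop : u ≠ ⊤ := ENNReal.prod_ne_top fun i _ => by finiteness
  have hbound : ENNReal.ofReal ((μD (d + 1) (rectAt (d + 1) N 0)).toReal ^ (-(1 / p))) ^ p =
      u⁻¹ := by
    rw [μD_rectAt_zero, ENNReal.toReal_rpow, ENNReal.ofReal_toReal
      (ENNReal.rpow_ne_top_of_ne_zero hu0 hutop), ← ENNReal.rpow_mul, neg_mul,
      one_div_mul_cancel hp0.ne', ENNReal.rpow_neg_one]
  have hmax : ∀ x, cesaroMaximal (d + 1) α γ β (fCoeff (d + 1) a) x ≤
      ENNReal.ofReal ((μD (d + 1) (rectAt (d + 1) N 0)).toReal ^ (-(1 / p))) *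
        ∏ i, Φ i (N i - r) (x i) := fun x => by
    refine iSup₂_le fun n hn => ?_
    by_cases hvan : ∀ m : Fin (d + 1) → ℕ, (∀ i, m i < n i) → ∀ i, m i < 2 ^ N i
    · simp [ha.cesaroOf_eq_zero α hvan]
    · push Not at hvan
      obtain ⟨m, hm, j, hj⟩ := hvan
      have hrn := hr N hN n hn (Nat.ne_zero_of_lt (hm 0)) ⟨j, hj.trans_lt (hm j)⟩
      refine (ha.abs_cesaroOf_le α n x).trans ?_
      gcongr with i
      exact (lintegral_mono_set (rectW_anti (Nat.sub_le (N i) r))).trans (hΦ i _ _ _ (hrn i))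
  calc ∫⁻ x in (rectAt (d + 1) (fun j => N j - r) 0)ᶜ,
        (cesaroMaximal (d + 1) α γ β (fCoeff (d + 1) a) x) ^ p ∂μD (d + 1)
      ≤ ∫⁻ x, (cesaroMaximal (d + 1) α γ β (fCoeff (d + 1) a) x) ^ p ∂μD (d + 1) :=
        setLIntegral_le_lintegral _ _
    _ ≤ ∫⁻ x, u⁻¹ * ∏ i, Φ i (N i - r) (x i) ^ p ∂μD (d + 1) := by
        refine lintegral_mono fun x => ?_
        refine (ENNReal.rpow_le_rpow (hmax x) hp0.le).trans_eq ?_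
        rw [ENNReal.mul_rpow_of_nonneg _ _ hp0.le, hbound,
          ENNReal.prod_rpow_of_nonneg hp0.le]
    _ = u⁻¹ * ∏ i, ∫⁻ y, Φ i (N i - r) y ^ p ∂μW := by
        rw [lintegral_const_mul' _ _ (ENNReal.inv_ne_top.2 hu0), μD,
          lintegral_pi_prod _ fun i => (hΦm i _).pow_const p]
    _ ≤ u⁻¹ * ∏ i, (C i * 2 ^ r) * 2⁻¹ ^ N i := by
        gcongr with i
        refine (hΦint i _).trans_eq ?_
        rw [mul_assoc]
        congr 1
        nth_rewrite 2 [← Nat.add_sub_of_le (hNr i)]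
        rw [pow_add, ← mul_assoc, ← mul_pow, ENNReal.mul_inv_cancel (by simp) (by simp), one_pow,
          one_mul]
    _ = ∏ i, C i * 2 ^ r := by
        rw [Finset.prod_mul_distrib, ← hu, mul_left_comm, ENNReal.inv_mul_cancel hu0 hutop, mul_one]

end
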